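/- For all decorated trees τ and τ' and every seed tree S, E[D_{τ,τ'}(T_n^{(S)})] ≪ E[D_τ(T_n^{(S)})] · E[D_{τ'}(T_n^{(S)})]. -/

import Mathlib

open Finset

noncomputable section

namespace LPAM

attribute [local instance] Classical.propDecidable

/-- The tree obtained from `G` by attaching a new vertex (the last element of `Fin (n+1)`)
to the vertex `v` of `G`. -/
def attach {n : ℕ} (G : SimpleGraph (Fin n)) (v : Fin n) : SimpleGraph (Fin (n + 1)) :=
  SimpleGraph.fromRel fun a b =>
    (∃ a' b' : Fin n, a = a'.castSucc ∧ b = b'.castSucc ∧ G.Adj a' b') ∨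
    (a = Fin.last n ∧ b = v.castSucc)

/-- The degree of a vertex. -/
def deg {n : ℕ} (G : SimpleGraph (Fin n)) (v : Fin n) : ℕ := (G.neighborSet v).ncard

/-- The law of the linear preferential attachment tree after `k` steps started from the
seed `S`: at each step, a new vertex is joined by an edge to a random vertex of the current
tree chosen with probability proportional to its degree. -/
def law {n₀ : ℕ} (S : SimpleGraph (Fin n₀)) : (k : ℕ) → SimpleGraph (Fin (n₀ + k)) → ℝ
  | 0, G => if G = S then 1 else 0
  | (k + 1), G =>
      ∑ H : SimpleGraph (Fin (n₀ + k)), ∑ v : Fin (n₀ + k),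
        law S k H * ((deg H v : ℝ) / (2 * (n₀ + k : ℕ) - 2)) *
          (if attach H v = G then 1 else 0)

/-- The law of the preferential attachment tree `T_n^{(S)}` with seed `S`, as a function on
graphs on `Fin n` (zero if `n < |S|`). -/
def lawAt {n₀ : ℕ} (S : SimpleGraph (Fin n₀)) (n : ℕ) (G : SimpleGraph (Fin n)) : ℝ :=
  if h : n₀ ≤ n then
    law S (n - n₀) (cast (congrArg (fun m => SimpleGraph (Fin m)) (Nat.add_sub_cancel' h).symm) G)
  else 0

/-- A decorated tree: a finite tree together with a positive integer label on each vertex. -/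
structure DecTree where
  n : ℕ
  graph : SimpleGraph (Fin n)
  isTree : graph.IsTree
  label : Fin n → ℕ
  label_pos : ∀ u, 0 < label u

/-- The weight of a decorated tree: the sum of its labels. -/
def DecTree.weight (τ : DecTree) : ℕ := ∑ u, τ.label u

/-- The strict partial order `≺` on decorated trees. -/
def DecTree.lt (τ' τ : DecTree) : Prop :=
  (τ'.weight < τ.weight ∧ τ'.n ≤ τ.n) ∨ (τ'.weight = τ.weight ∧ τ'.n < τ.n)

/-- The partial order `⪯` associated with `≺`. -/
def DecTree.le (τ' τ : DecTree) : Prop := DecTree.lt τ' τ ∨ τ' = τ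

/-- The observable `D_τ(T) = ∑_φ ∏_{u ∈ τ} [deg_T φ(u)]_{ℓ(u)}`, the sum running over all
embeddings (injective graph homomorphisms) `φ : τ → T`. -/
def Dval (τ : DecTree) {m : ℕ} (T : SimpleGraph (Fin m)) : ℝ :=
  ∑ φ : Fin τ.n → Fin m,
    if Function.Injective φ ∧ ∀ a b, τ.graph.Adj a b → T.Adj (φ a) (φ b) then
      ∏ u, ((deg T (φ u)).descFactorial (τ.label u) : ℝ)
    else 0

/-- The expectation `E[D_τ(T_n^{(S)})]`. -/
def expD {n₀ : ℕ} (S : SimpleGraph (Fin n₀)) (τ : DecTree) (n : ℕ) : ℝ :=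
  ∑ G : SimpleGraph (Fin n), lawAt S n G * Dval τ G

/-- `a ≪ b` : there are `c > 0` and `γ ∈ ℝ` with `|a_n| ≤ c (log n)^γ |b_n|` for `n` large. -/
def Lsim (a b : ℕ → ℝ) : Prop :=
  ∃ c γ : ℝ, 0 < c ∧ ∀ᶠ n : ℕ in Filter.atTop, |a n| ≤ c * Real.log n ^ γ * |b n|

end LPAM

namespace LPAM

attribute [local instance] Classical.propDecidable

/-- The observable `D_{τ,τ'}(T)`: the sum over all injective graph homomorphisms `φ` from the
disjoint union `τ ⊔ τ'` to `T` of `∏_{u ∈ τ ⊔ τ'} [deg_T φ(u)]_{ℓ(u)}`. -/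
def Dpair (τ τ' : DecTree) {m : ℕ} (T : SimpleGraph (Fin m)) : ℝ :=
  ∑ φ : Fin τ.n → Fin m, ∑ ψ : Fin τ'.n → Fin m,
    if Function.Injective φ ∧ Function.Injective ψ ∧ (∀ a b, φ a ≠ ψ b) ∧
        (∀ a b, τ.graph.Adj a b → T.Adj (φ a) (φ b)) ∧
        (∀ a b, τ'.graph.Adj a b → T.Adj (ψ a) (ψ b)) then
      (∏ u, ((deg T (φ u)).descFactorial (τ.label u) : ℝ)) *
        ∏ u, ((deg T (ψ u)).descFactorial (τ'.label u) : ℝ)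
    else 0

section Attach

variable {n : ℕ} (G : SimpleGraph (Fin n)) (v : Fin n)

lemma attach_adj_castSucc (a b : Fin n) :
    (attach G v).Adj a.castSucc b.castSucc ↔ G.Adj a b := by
  constructor
  · rintro ⟨-, (⟨a', b', ha, hb, h⟩ | ⟨ha, -⟩) | (⟨a', b', ha, hb, h⟩ | ⟨ha, -⟩)⟩
    · rw [Fin.castSucc_inj] at ha hb
      subst ha hb
      exact h
    · exact absurd ha (Fin.castSucc_lt_last a).ne
    · rw [Fin.castSucc_inj] at ha hb
      subst ha hb
      exact h.symm
    · exact absurd ha (Fin.castSucc_lt_last b).ne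
  · intro h
    exact ⟨fun e => h.ne (Fin.castSucc_inj.1 e), Or.inl (Or.inl ⟨a, b, rfl, rfl, h⟩)⟩

lemma attach_adj_last_castSucc (a : Fin n) :
    (attach G v).Adj (Fin.last n) a.castSucc ↔ a = v := by
  constructor
  · rintro ⟨-, (⟨a', b', ha, hb, h⟩ | ⟨-, ha⟩) | (⟨a', b', ha, hb, h⟩ | ⟨ha, -⟩)⟩
    · exact absurd ha (Fin.castSucc_lt_last a').ne'
    · exact Fin.castSucc_inj.1 ha
    · exact absurd hb (Fin.castSucc_lt_last b').ne'
    · exact absurd ha (Fin.castSucc_lt_last a).ne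
  · rintro rfl
    exact ⟨(Fin.castSucc_lt_last a).ne', Or.inl (Or.inr ⟨rfl, rfl⟩)⟩

lemma attach_adj_castSucc_last (a : Fin n) :
    (attach G v).Adj a.castSucc (Fin.last n) ↔ a = v := by
  rw [SimpleGraph.adj_comm, attach_adj_last_castSucc]

lemma deg_eq_sum (p : Fin n) : deg G p = ∑ c, if G.Adj p c then 1 else 0 := by
  rw [deg, Set.ncard_eq_toFinset_card', Finset.sum_boole]
  simp only [Nat.cast_id]
  congr 1
  ext c
  simp

lemma deg_attach_castSucc (p : Fin n) :
    deg (attach G v) p.castSucc = deg G p + if p = v then 1 else 0 := by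
  simp only [deg_eq_sum, Fin.sum_univ_castSucc, attach_adj_castSucc, attach_adj_castSucc_last]

lemma deg_attach_last : deg (attach G v) (Fin.last n) = 1 := by
  rw [deg_eq_sum, Fin.sum_univ_castSucc]
  simp [attach_adj_last_castSucc, -Finset.sum_boole]

/-- The sum of the degrees of those neighbours of `p` that are younger than `p`. -/
def childDeg (p : Fin n) : ℕ := ∑ c, if G.Adj p c ∧ p < c then deg G c else 0

lemma childDeg_attach_castSucc (p : Fin n) :
    childDeg (attach G v) p.castSucc =
      childDeg G p + ((if v = p then 1 else 0) + if G.Adj p v ∧ p < v then 1 else 0) := by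
  have h : ∀ c, (if G.Adj p c ∧ p < c then deg G c + (if c = v then 1 else 0) else 0)
      = (if G.Adj p c ∧ p < c then deg G c else 0) +
        if c = v then (if G.Adj p c ∧ p < c then 1 else 0) else 0 := by
    intro c
    split_ifs <;> simp
  simp only [childDeg, Fin.sum_univ_castSucc, attach_adj_castSucc, attach_adj_castSucc_last,
    Fin.castSucc_lt_castSucc_iff, Fin.castSucc_lt_last, deg_attach_castSucc, deg_attach_last,
    and_true, h, Finset.sum_add_distrib, Finset.sum_ite_eq', Finset.mem_univ, if_true,
    eq_comm (a := p) (b := v)]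
  ring

lemma childDeg_attach_last : childDeg (attach G v) (Fin.last n) = 0 := by
  simp [childDeg, Fin.sum_univ_castSucc, Fin.le_last]

/-- The number of neighbours of `p` that are older than `p`. -/
def oldDeg (p : Fin n) : ℕ := ∑ c, if G.Adj p c ∧ c < p then 1 else 0

lemma oldDeg_attach_castSucc (p : Fin n) :
    oldDeg (attach G v) p.castSucc = oldDeg G p := by
  rw [oldDeg, Fin.sum_univ_castSucc]
  simp [oldDeg, attach_adj_castSucc, Fin.le_last, -Finset.sum_boole]

lemma oldDeg_attach_last : oldDeg (attach G v) (Fin.last n) = 1 := by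
  rw [oldDeg, Fin.sum_univ_castSucc]
  simp [attach_adj_last_castSucc, Fin.castSucc_lt_last, -Finset.sum_boole]

end Attach

/-- Properties shared by all trees that the model reaches from a seed with `n₀` vertices. -/
structure Reachable (n₀ : ℕ) {n : ℕ} (G : SimpleGraph (Fin n)) : Prop where
  sum_deg : ∑ v, (deg G v : ℝ) = 2 * n - 2
  deg_pos : ∀ v, 0 < deg G v
  oldDeg_le : ∀ v, oldDeg G v ≤ n₀

lemma Reachable.attach {n₀ n : ℕ} {G : SimpleGraph (Fin n)} (h : Reachable n₀ G)
    (hn₀ : 1 ≤ n₀) (v : Fin n) : Reachable n₀ (attach G v) where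
  sum_deg := by
    simp only [Fin.sum_univ_castSucc, deg_attach_castSucc, deg_attach_last]
    push_cast
    rw [Finset.sum_add_distrib, h.sum_deg]
    simp
    ring
  deg_pos := by
    intro u
    refine Fin.lastCases ?_ (fun u => ?_) u
    · rw [deg_attach_last]; exact one_pos
    · rw [deg_attach_castSucc]; exact Nat.add_pos_left (h.deg_pos u) _
  oldDeg_le := by
    intro u
    refine Fin.lastCases ?_ (fun u => ?_) u
    · rw [oldDeg_attach_last]; exact hn₀
    · rw [oldDeg_attach_castSucc]; exact h.oldDeg_le u

lemma deg_eq_degree {n : ℕ} (G : SimpleGraph (Fin n)) (v : Fin n) : deg G v = G.degree v := by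
  rw [deg, Set.ncard_eq_toFinset_card', ← SimpleGraph.card_neighborFinset_eq_degree]
  rfl

lemma reachable_seed {n₀ : ℕ} {S : SimpleGraph (Fin n₀)} (hS : S.IsTree) (hn₀ : 2 ≤ n₀) :
    Reachable n₀ S where
  sum_deg := by
    have h1 := S.sum_degrees_eq_twice_card_edges
    have h2 := hS.card_edgeFinset
    simp only [deg_eq_degree]
    rw [← Nat.cast_sum, h1]
    rw [Fintype.card_fin] at h2
    have h3 : ((#S.edgeFinset : ℕ) : ℝ) + 1 = n₀ := by exact_mod_cast h2
    push_cast
    linarith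
  deg_pos := by
    intro v
    have : Nontrivial (Fin n₀) := Fin.nontrivial_iff_two_le.2 hn₀
    rw [deg_eq_degree]
    exact hS.connected.preconnected.degree_pos_of_nontrivial v
  oldDeg_le := by
    intro v
    calc oldDeg S v ≤ ∑ _c : Fin n₀, 1 := by
          refine Finset.sum_le_sum fun c _ => ?_
          split_ifs <;> simp
      _ = n₀ := by simp

section Expectation

variable {n₀ : ℕ} (S : SimpleGraph (Fin n₀))

/-- The expectation of `F` under the law of the tree after `k` steps. -/
def expect (k : ℕ) (F : SimpleGraph (Fin (n₀ + k)) → ℝ) : ℝ := ∑ G, law S k G * F G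

lemma law_nonneg (hn₀ : 2 ≤ n₀) (k : ℕ) (G : SimpleGraph (Fin (n₀ + k))) : 0 ≤ law S k G := by
  induction k with
  | zero => simp only [law]; split_ifs <;> norm_num
  | succ k ih =>
    simp only [law]
    refine Finset.sum_nonneg fun H _ => Finset.sum_nonneg fun v _ => ?_
    have h : (2 : ℝ) ≤ ((n₀ + k : ℕ) : ℝ) := by exact_mod_cast le_add_right hn₀
    refine mul_nonneg (mul_nonneg (ih H) (div_nonneg (Nat.cast_nonneg _) (by linarith))) ?_
    split_ifs <;> norm_num

lemma expect_zero (F : SimpleGraph (Fin n₀) → ℝ) : expect S 0 F = F S := by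
  simp [expect, law]

lemma expect_succ (k : ℕ) (F : SimpleGraph (Fin (n₀ + k + 1)) → ℝ) :
    expect S (k + 1) F = expect S k fun H =>
      (∑ v, (deg H v : ℝ) * F (attach H v)) / (2 * (n₀ + k : ℕ) - 2) := by
  simp only [expect, law, Finset.sum_mul]
  rw [Finset.sum_comm]
  refine Finset.sum_congr rfl fun H _ => ?_
  rw [Finset.sum_comm, Finset.sum_div, Finset.mul_sum]
  refine Finset.sum_congr rfl fun v _ => ?_
  refine (Finset.sum_eq_single (attach H v) (fun G _ hG => ?_) (by simp)).trans ?_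
  · rw [if_neg (Ne.symm hG)]; ring
  · rw [if_pos rfl]; ring

lemma reachable_of_law_ne_zero {S : SimpleGraph (Fin n₀)} (hS : S.IsTree) (hn₀ : 2 ≤ n₀) (k : ℕ)
    {G : SimpleGraph (Fin (n₀ + k))} (hG : law S k G ≠ 0) : Reachable n₀ G := by
  induction k with
  | zero =>
    simp only [law] at hG
    have : G = S := by by_contra h; simp [h] at hG
    subst this
    exact reachable_seed hS hn₀
  | succ k ih =>
    simp only [law] at hG
    obtain ⟨H, -, hH⟩ := Finset.exists_ne_zero_of_sum_ne_zero hG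
    obtain ⟨v, -, hv⟩ := Finset.exists_ne_zero_of_sum_ne_zero hH
    have h1 : law S k H ≠ 0 := left_ne_zero_of_mul (left_ne_zero_of_mul hv)
    have h2 : LPAM.attach H v = G := by
      by_contra h
      simp [h] at hv
    rw [← h2]
    exact (ih h1).attach (by omega) v

lemma law_attach_pos {S : SimpleGraph (Fin n₀)} (hS : S.IsTree) (hn₀ : 2 ≤ n₀) {k : ℕ}
    {H : SimpleGraph (Fin (n₀ + k))} (hH : 0 < law S k H) (v : Fin (n₀ + k)) :
    0 < law S (k + 1) (attach H v) := by
  have h : (2 : ℝ) ≤ ((n₀ + k : ℕ) : ℝ) := by exact_mod_cast le_add_right hn₀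
  have hd : (0 : ℝ) < deg H v :=
    Nat.cast_pos.2 ((reachable_of_law_ne_zero hS hn₀ k hH.ne').deg_pos v)
  have hnn : ∀ (H' : SimpleGraph (Fin (n₀ + k))) (u : Fin (n₀ + k)),
      0 ≤ law S k H' * ((deg H' u : ℝ) / (2 * (n₀ + k : ℕ) - 2)) *
          (if attach H' u = attach H v then 1 else 0) := by
    intro H' u
    refine mul_nonneg (mul_nonneg (law_nonneg S hn₀ k H')
      (div_nonneg (Nat.cast_nonneg _) (by linarith))) ?_
    split_ifs <;> norm_num
  simp only [law]
  refine Finset.sum_pos' (fun H' _ => Finset.sum_nonneg fun u _ => hnn H' u)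
    ⟨H, Finset.mem_univ _, ?_⟩
  refine Finset.sum_pos' (fun u _ => hnn H u) ⟨v, Finset.mem_univ _, ?_⟩
  rw [if_pos rfl, mul_one]
  exact mul_pos hH (div_pos hd (by linarith))

lemma expect_mono {S : SimpleGraph (Fin n₀)} (hS : S.IsTree) (hn₀ : 2 ≤ n₀) {k : ℕ}
    {F F' : SimpleGraph (Fin (n₀ + k)) → ℝ} (h : ∀ G, Reachable n₀ G → F G ≤ F' G) :
    expect S k F ≤ expect S k F' := by
  refine Finset.sum_le_sum fun G _ => ?_
  by_cases hG : law S k G = 0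
  · simp [hG]
  · exact mul_le_mul_of_nonneg_left (h G (reachable_of_law_ne_zero hS hn₀ k hG))
      (law_nonneg S hn₀ k G)

lemma expect_nonneg (hn₀ : 2 ≤ n₀) {k : ℕ} {F : SimpleGraph (Fin (n₀ + k)) → ℝ}
    (h : ∀ G, 0 ≤ F G) : 0 ≤ expect S k F :=
  Finset.sum_nonneg fun G _ => mul_nonneg (law_nonneg S hn₀ k G) (h G)

lemma expect_congr {S : SimpleGraph (Fin n₀)} (hS : S.IsTree) (hn₀ : 2 ≤ n₀) {k : ℕ}
    {F F' : SimpleGraph (Fin (n₀ + k)) → ℝ} (h : ∀ G, Reachable n₀ G → F G = F' G) :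
    expect S k F = expect S k F' :=
  le_antisymm (expect_mono hS hn₀ fun G hG => (h G hG).le)
    (expect_mono hS hn₀ fun G hG => (h G hG).ge)

lemma expect_add (k : ℕ) (F F' : SimpleGraph (Fin (n₀ + k)) → ℝ) :
    expect S k (fun G => F G + F' G) = expect S k F + expect S k F' := by
  simp only [expect, mul_add, Finset.sum_add_distrib]

lemma expect_const_mul (k : ℕ) (c : ℝ) (F : SimpleGraph (Fin (n₀ + k)) → ℝ) :
    expect S k (fun G => c * F G) = c * expect S k F := by
  simp only [expect, Finset.mul_sum, mul_left_comm]

lemma expect_sum {ι : Type*} (s : Finset ι) (k : ℕ) (F : ι → SimpleGraph (Fin (n₀ + k)) → ℝ) :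
    expect S k (fun G => ∑ i ∈ s, F i G) = ∑ i ∈ s, expect S k (F i) := by
  simp only [expect, Finset.mul_sum]
  exact Finset.sum_comm

lemma expect_const {S : SimpleGraph (Fin n₀)} (hS : S.IsTree) (hn₀ : 2 ≤ n₀) (k : ℕ) (c : ℝ) :
    expect S k (fun _ => c) = c := by
  induction k with
  | zero => exact expect_zero S _
  | succ k ih =>
    have h : (2 : ℝ) ≤ ((n₀ + k : ℕ) : ℝ) := by exact_mod_cast le_add_right hn₀
    refine (expect_succ S k _).trans (Eq.trans ?_ ih)
    refine expect_congr hS hn₀ fun G hG => ?_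
    rw [← Finset.sum_mul, hG.sum_deg, mul_comm, mul_div_assoc, div_self (by linarith), mul_one]

lemma expect_mul_sq_le (hn₀ : 2 ≤ n₀) (k : ℕ) (F F' : SimpleGraph (Fin (n₀ + k)) → ℝ) :
    expect S k (fun G => F G * F' G) ^ 2 ≤
      expect S k (fun G => F G ^ 2) * expect S k (fun G => F' G ^ 2) := by
  refine Finset.sum_sq_le_sum_mul_sum_of_sq_le_mul _ (fun G _ => ?_) (fun G _ => ?_) fun G _ => ?_
  · exact mul_nonneg (law_nonneg S hn₀ k G) (sq_nonneg _)
  · exact mul_nonneg (law_nonneg S hn₀ k G) (sq_nonneg _)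
  · exact le_of_eq (by ring)

lemma sum_lawAt (k : ℕ) (F : SimpleGraph (Fin (n₀ + k)) → ℝ) :
    ∑ G, lawAt S (n₀ + k) G * F G = expect S k F := by
  refine Finset.sum_congr rfl fun G _ => ?_
  have key : ∀ (m : ℕ) (h : n₀ + k = n₀ + m),
      law S m (cast (congrArg (fun m => SimpleGraph (Fin m)) h) G) = law S k G := by
    intro m h
    obtain rfl : m = k := by omega
    rfl
  rw [lawAt, dif_pos (Nat.le_add_right _ _), key _ (by omega)]

end Expectation

section Moments

lemma pow_add_mul_le_add_pow {x y : ℝ} (hx : 0 ≤ x) (hy : 0 ≤ y) (b : ℕ) :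
    x ^ b + b * x ^ (b - 1) * y ≤ (x + y) ^ b := by
  cases b with
  | zero => simp
  | succ b =>
    induction b with
    | zero => simp
    | succ b ih =>
      rw [Nat.add_sub_cancel] at ih ⊢
      calc x ^ (b + 1 + 1) + ((b + 1 + 1 : ℕ) : ℝ) * x ^ (b + 1) * y
          ≤ (x + y) * (x ^ (b + 1) + ((b + 1 : ℕ) : ℝ) * x ^ b * y) := by
            have : 0 ≤ ((b : ℝ) + 1) * x ^ b * y ^ 2 := by positivity
            push_cast
            ring_nf at this ⊢
            linarith
        _ ≤ (x + y) * (x + y) ^ (b + 1) := by gcongr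
        _ = _ := by ring

lemma succ_ascFactorial_le {x : ℕ} (hx : 1 ≤ x) (b : ℕ) :
    (x + 1).ascFactorial b ≤ x.ascFactorial b + b ^ 2 * x.ascFactorial (b - 1) := by
  cases b with
  | zero => simp
  | succ b =>
    have h1 : x * (x + 1).ascFactorial b = (x + b) * x.ascFactorial b := Nat.succ_ascFactorial x b
    have h2 : (x + 1).ascFactorial b ≤ (b + 1) * x.ascFactorial b := by
      refine le_of_mul_le_mul_left ?_ (Nat.pos_of_ne_zero (by omega : x ≠ 0))
      rw [h1]
      calc (x + b) * x.ascFactorial b ≤ (x * (b + 1)) * x.ascFactorial b :=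
            Nat.mul_le_mul_right _ (by nlinarith)
        _ = _ := by ring
    rw [Nat.ascFactorial_succ, Nat.ascFactorial_succ, Nat.add_sub_cancel]
    calc (x + 1 + b) * (x + 1).ascFactorial b
        = x * (x + 1).ascFactorial b + (b + 1) * (x + 1).ascFactorial b := by ring
      _ ≤ (x + b) * x.ascFactorial b + (b + 1) * ((b + 1) * x.ascFactorial b) := by
          rw [h1]; gcongr
      _ = _ := by ring

/-- The mixed rising factorial moment of the degree and of `childDeg` at a vertex. -/
def vertexMoment (a b : ℕ) {n : ℕ} (G : SimpleGraph (Fin n)) (p : Fin n) : ℝ :=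
  ((deg G p).ascFactorial a : ℝ) * ((childDeg G p + 1).ascFactorial b : ℝ)

lemma vertexMoment_nonneg (a b : ℕ) {n : ℕ} (G : SimpleGraph (Fin n)) (p : Fin n) :
    0 ≤ vertexMoment a b G p := by
  unfold vertexMoment; positivity

lemma vertexMoment_step_aux (d s a b : ℕ) :
    (d : ℝ) * (((d + 1).ascFactorial a : ℝ) * ((s + 2).ascFactorial b : ℝ)) +
      s * ((d.ascFactorial a : ℝ) * ((s + 2).ascFactorial b : ℝ)) ≤
    (d + s + a + b) * ((d.ascFactorial a : ℝ) * ((s + 1).ascFactorial b : ℝ)) +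
      b ^ 2 * ((d.ascFactorial (a + 1) : ℝ) * ((s + 1).ascFactorial (b - 1) : ℝ)) := by
  have h1 : (d : ℝ) * ((d + 1).ascFactorial a : ℝ) = (d + a) * d.ascFactorial a := by
    exact_mod_cast Nat.succ_ascFactorial d a
  have h2 : ((s : ℝ) + 1) * ((s + 2).ascFactorial b : ℝ) =
      (s + 1 + b) * (s + 1).ascFactorial b := by
    exact_mod_cast Nat.succ_ascFactorial (s + 1) b
  have h3 : ((s + 2).ascFactorial b : ℝ) ≤
      (s + 1).ascFactorial b + b ^ 2 * (s + 1).ascFactorial (b - 1) := by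
    exact_mod_cast succ_ascFactorial_le (Nat.le_add_left 1 s) b
  have h4 : (d.ascFactorial (a + 1) : ℝ) = (d + a) * d.ascFactorial a := by
    exact_mod_cast Nat.ascFactorial_succ
  have h5 : ((s + 1).ascFactorial b : ℝ) ≤ ((s + 2).ascFactorial b : ℝ) := by
    exact_mod_cast Nat.ascFactorial_le b (Nat.le_succ _)
  have e1 : (d : ℝ) * (((d + 1).ascFactorial a : ℝ) * ((s + 2).ascFactorial b : ℝ)) =
      (d + a) * d.ascFactorial a * ((s + 2).ascFactorial b : ℝ) := by rw [← h1]; ring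
  have e2 : (s : ℝ) * ((s + 2).ascFactorial b : ℝ) =
      (s + 1 + b) * (s + 1).ascFactorial b - ((s + 2).ascFactorial b : ℝ) := by rw [← h2]; ring
  rw [e1, h4]
  have hx : (0 : ℝ) ≤ d.ascFactorial a := Nat.cast_nonneg _
  have m1 := mul_le_mul_of_nonneg_left h3 (mul_nonneg (by positivity : (0 : ℝ) ≤ d + a) hx)
  have m2 : (s : ℝ) * ((d.ascFactorial a : ℝ) * ((s + 2).ascFactorial b : ℝ)) ≤
      d.ascFactorial a * ((s + b) * (s + 1).ascFactorial b) := by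
    rw [mul_left_comm, e2]
    refine mul_le_mul_of_nonneg_left ?_ hx
    linarith
  linarith

lemma sum_deg_mul_vertexMoment_attach_le {n₀ n : ℕ} {G : SimpleGraph (Fin n)} (h : Reachable n₀ G)
    (a b : ℕ) (p : Fin n) :
    ∑ v, (deg G v : ℝ) * vertexMoment a b (attach G v) p.castSucc ≤
      (2 * n - 2 + a + b) * vertexMoment a b G p + b ^ 2 * vertexMoment (a + 1) (b - 1) G p := by
  set d := deg G p with hd
  set s := childDeg G p with hs
  set f := ((d.ascFactorial a : ℝ) * ((s + 1).ascFactorial b : ℝ)) with hf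
  set g := (((d + 1).ascFactorial a : ℝ) * ((s + 2).ascFactorial b : ℝ)) with hg
  set q := ((d.ascFactorial a : ℝ) * ((s + 2).ascFactorial b : ℝ)) with hq
  have key : ∀ v, (deg G v : ℝ) * vertexMoment a b (attach G v) p.castSucc =
      deg G v * f + (if v = p then (deg G v : ℝ) * (g - f) else 0) +
        (if G.Adj p v ∧ p < v then (deg G v : ℝ) else 0) * (q - f) := by
    intro v
    rw [vertexMoment, deg_attach_castSucc, childDeg_attach_castSucc]
    by_cases h1 : v = p
    · subst h1
      simp only [lt_irrefl, and_false, if_true, if_false, ← hd, ← hs]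
      rw [hg, hf]
      simp only [add_zero]
      ring
    · by_cases h2 : G.Adj p v ∧ p < v
      · simp only [h1, h2, Ne.symm h1, and_self, if_true, if_false, ← hd, ← hs, add_zero, zero_add]
        rw [hq, hf]
        ring
      · simp only [h1, h2, Ne.symm h1, if_false, ← hd, ← hs, add_zero]
        rw [hf]
        ring
  have hc : ∑ v, (if G.Adj p v ∧ p < v then (deg G v : ℝ) else 0) = s := by
    rw [hs, childDeg]
    push_cast
    rfl
  simp only [key, Finset.sum_add_distrib, ← Finset.sum_mul, h.sum_deg, hc, Finset.sum_ite_eq',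
    Finset.mem_univ, if_true]
  have := vertexMoment_step_aux d s a b
  simp only [vertexMoment, ← hd, ← hs]
  linarith

/-- Partial sums of the harmonic series. -/
def hsum (n : ℕ) : ℝ := ∑ i ∈ Finset.range n, 1 / ((i : ℝ) + 1)

lemma hsum_succ (n : ℕ) : hsum (n + 1) = hsum n + 1 / ((n : ℝ) + 1) := Finset.sum_range_succ _ _

lemma one_le_hsum {n : ℕ} (hn : 1 ≤ n) : 1 ≤ hsum n := by
  induction n, hn using Nat.le_induction with
  | base => simp [hsum]
  | succ n _ ih =>
    rw [hsum_succ]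
    have : 0 ≤ 1 / ((n : ℝ) + 1) := by positivity
    linarith

lemma hsum_le (n : ℕ) : hsum n ≤ 1 + Real.log n := by
  have := harmonic_le_one_add_log n
  simpa [hsum, harmonic, one_div] using this

lemma growth_step_le {u t B C C' P P' Q Q' R e : ℝ} (hu : 0 ≤ u) (hC : 0 ≤ C)
    (hP' : 0 ≤ P') (hQ : 0 ≤ Q) (he : 0 ≤ e) (hR : 0 ≤ R) (ht : t * (B * C') ≤ C * e)
    (hP : P + e * R ≤ P') (hQ' : (1 + u) * Q ≤ Q') :
    (1 + u) * (C * P * Q) + t * (B * (C' * R * Q)) ≤ C * P' * Q' := by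
  have hRQ : 0 ≤ R * Q := mul_nonneg hR hQ
  calc (1 + u) * (C * P * Q) + t * (B * (C' * R * Q))
      = (1 + u) * (C * P * Q) + t * (B * C') * (R * Q) := by ring
    _ ≤ (1 + u) * (C * P * Q) + C * e * (R * Q) := by gcongr
    _ ≤ (1 + u) * (C * P * Q) + (1 + u) * (C * e * (R * Q)) := by
        have : 0 ≤ u * (C * e * (R * Q)) := by positivity
        linarith
    _ = C * (P + e * R) * ((1 + u) * Q) := by ring
    _ ≤ C * P' * Q' := by gcongr

variable {n₀ : ℕ} {S : SimpleGraph (Fin n₀)}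

lemma exists_expect_vertexMoment_le (hS : S.IsTree) (hn₀ : 2 ≤ n₀) (j b : ℕ) (hb : b ≤ 2 * j) :
    ∃ C : ℝ, 0 ≤ C ∧ ∀ k, ∀ p : Fin (n₀ + k),
      expect S k (fun G => vertexMoment (2 * j - b) b G p) ≤
        C * hsum (n₀ + k) ^ b * ((((n₀ + k : ℕ) : ℝ) - 1) / ((p : ℕ) + 1)) ^ j := by
  obtain ⟨C', hC', hle⟩ : ∃ C' : ℝ, 0 ≤ C' ∧ ∀ k, ∀ p : Fin (n₀ + k),
      (b : ℝ) ^ 2 * expect S k (fun G => vertexMoment (2 * j - b + 1) (b - 1) G p) ≤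
        (b : ℝ) ^ 2 * (C' * hsum (n₀ + k) ^ (b - 1) *
          ((((n₀ + k : ℕ) : ℝ) - 1) / ((p : ℕ) + 1)) ^ j) := by
    cases b with
    | zero => exact ⟨0, le_rfl, by simp⟩
    | succ b =>
      obtain ⟨C', hC', h⟩ := exists_expect_vertexMoment_le hS hn₀ j b (by omega)
      refine ⟨C', hC', fun k p => mul_le_mul_of_nonneg_left ?_ (sq_nonneg _)⟩
      rw [show 2 * j - (b + 1) + 1 = 2 * j - b by omega, Nat.add_sub_cancel]
      exact h k p
  set a := 2 * j - b with ha
  have hab : (a : ℝ) + b = 2 * j := by exact_mod_cast (by omega : a + b = 2 * j)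
  set M : ℝ := ∑ p, vertexMoment a b S p with hM
  have hM0 : 0 ≤ M := Finset.sum_nonneg fun p _ => vertexMoment_nonneg _ _ _ _
  set A : ℝ := (((1 : ℕ).ascFactorial a : ℝ) * ((0 + 1 : ℕ).ascFactorial b : ℝ)) with hA
  have hA0 : 0 ≤ A := by positivity
  set C : ℝ := M * n₀ ^ j + 2 ^ j * A + 2 * b * C' with hC
  have hC0 : 0 ≤ C := by positivity
  refine ⟨C, hC0, fun k => ?_⟩
  induction k with
  | zero =>
    intro p
    rw [expect_zero]
    have hn : (2 : ℝ) ≤ n₀ := by exact_mod_cast hn₀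
    have hz : ((n₀ + 0 : ℕ) : ℝ) = n₀ := rfl
    have hp : ((p : ℕ) : ℝ) + 1 ≤ n₀ := by exact_mod_cast p.2
    have hp0 : (0 : ℝ) < ((p : ℕ) : ℝ) + 1 := by positivity
    have h1 : vertexMoment a b S p ≤ M :=
      Finset.single_le_sum (f := fun p => vertexMoment a b S p)
        (fun p _ => vertexMoment_nonneg _ _ _ _) (Finset.mem_univ p)
    have h2 : 1 ≤ hsum (n₀ + 0) ^ b := one_le_pow₀ (one_le_hsum (by omega))
    have h3 : 1 ≤ (n₀ : ℝ) * ((((n₀ + 0 : ℕ) : ℝ) - 1) / ((p : ℕ) + 1)) := by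
      rw [← mul_div_assoc, le_div_iff₀ hp0, hz]
      nlinarith
    have hr : 0 ≤ ((((n₀ + 0 : ℕ) : ℝ) - 1) / ((p : ℕ) + 1)) := by
      refine div_nonneg ?_ hp0.le
      rw [hz]
      linarith
    calc vertexMoment a b S p ≤ M * 1 * 1 := by linarith
      _ ≤ M * hsum (n₀ + 0) ^ b * ((n₀ : ℝ) * ((((n₀ + 0 : ℕ) : ℝ) - 1) / ((p : ℕ) + 1))) ^ j := by
          gcongr
          exact one_le_pow₀ h3
      _ = (M * n₀ ^ j) * hsum (n₀ + 0) ^ b * ((((n₀ + 0 : ℕ) : ℝ) - 1) / ((p : ℕ) + 1)) ^ j := by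
          rw [mul_pow]; ring
      _ ≤ _ := by
          gcongr
          have : 0 ≤ 2 ^ j * A + 2 * b * C' := by positivity
          linarith
  | succ k ih =>
    intro p
    have hN2 : (2 : ℝ) ≤ ((n₀ + k : ℕ) : ℝ) := by exact_mod_cast le_add_right hn₀
    have hH1 : 1 ≤ hsum (n₀ + k) := one_le_hsum (by omega)
    have hHs : hsum (n₀ + (k + 1)) = hsum (n₀ + k) + 1 / (((n₀ + k : ℕ) : ℝ) + 1) := hsum_succ _
    have hNs : ((n₀ + (k + 1) : ℕ) : ℝ) - 1 = ((n₀ + k : ℕ) : ℝ) := by push_cast; ring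
    have hstep := expect_succ S k (fun G => vertexMoment a b G p)
    rw [hHs, hNs]
    refine hstep.trans_le ?_
    clear hstep hHs hNs
    set H := hsum (n₀ + k)
    set N := ((n₀ + k : ℕ) : ℝ) with hN
    have hH' : 1 ≤ H + 1 / (N + 1) := by
      have : 0 ≤ 1 / (N + 1) := by positivity
      linarith
    refine Fin.lastCases ?_ (fun p => ?_) p
    · have hx : expect S k (fun H => (∑ v, (deg H v : ℝ) *
          vertexMoment a b (attach H v) (Fin.last (n₀ + k))) / (2 * N - 2)) = A := by
        rw [← expect_const hS hn₀ k A]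
        refine expect_congr hS hn₀ fun G hG => ?_
        simp only [vertexMoment, deg_attach_last, childDeg_attach_last]
        rw [← Finset.sum_mul, hG.sum_deg, mul_comm, mul_div_assoc, div_self (by linarith), mul_one]
      refine hx.le.trans ?_
      have hlast : (((Fin.last (n₀ + k) : Fin (n₀ + k + 1)) : ℕ) : ℝ) = N := by simp [hN]
      have h3 : 1 ≤ 2 * (N / (N + 1)) := by
        rw [← mul_div_assoc, le_div_iff₀ (by linarith)]
        linarith
      calc A = A * 1 * 1 := by ring
        _ ≤ A * (H + 1 / (N + 1)) ^ b * (2 * (N / (N + 1))) ^ j := by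
            gcongr
            · exact one_le_pow₀ hH'
            · exact one_le_pow₀ h3
        _ = (2 ^ j * A) * (H + 1 / (N + 1)) ^ b * (N / (N + 1)) ^ j := by rw [mul_pow]; ring
        _ ≤ C * (H + 1 / (N + 1)) ^ b * (N / (N + 1)) ^ j := by
            gcongr
            have : 0 ≤ M * n₀ ^ j + 2 * b * C' := by positivity
            linarith
        _ = _ := by rw [← hlast]; rfl
    · have hp0 : (0 : ℝ) < ((p : ℕ) : ℝ) + 1 := by positivity
      set r := (N - 1) / (((p : ℕ) : ℝ) + 1) with hr
      have hr0 : 0 ≤ r := div_nonneg (by linarith) hp0.le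
      have hD : 0 < 2 * N - 2 := by linarith
      have h1 : expect S k (fun H => (∑ v, (deg H v : ℝ) *
          vertexMoment a b (attach H v) p.castSucc) / (2 * N - 2)) ≤
          (1 + j / (N - 1)) * expect S k (fun G => vertexMoment a b G p) +
          1 / (2 * N - 2) *
            ((b : ℝ) ^ 2 * expect S k (fun G => vertexMoment (a + 1) (b - 1) G p)) := by
        rw [← expect_const_mul, ← expect_const_mul, ← expect_const_mul, ← expect_add]
        refine expect_mono hS hn₀ fun G hG => ?_
        rw [div_le_iff₀ hD]
        refine (sum_deg_mul_vertexMoment_attach_le hG a b p).trans (le_of_eq ?_)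
        have : N - 1 ≠ 0 := by linarith
        have e : (2 * N - 2 + a + b : ℝ) = (1 + j / (N - 1)) * (2 * N - 2) := by
          rw [add_assoc, hab]; field_simp
        rw [e]
        field_simp
      have h2 := ih p
      have h3 := hle k p
      have hj : (1 + (j : ℝ) / (N - 1)) ≤ (1 + 1 / (N - 1)) ^ j := by
        have := one_add_mul_le_pow (a := 1 / (N - 1))
          (le_trans (by norm_num) (div_nonneg zero_le_one (by linarith : (0:ℝ) ≤ N - 1))) j
        rwa [mul_one_div] at this
      have hrs : r * (1 + 1 / (N - 1)) = N / (((p : ℕ) : ℝ) + 1) := by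
        have : N - 1 ≠ 0 := by linarith
        rw [hr]; field_simp; ring
      have hHb : H ^ b + b * H ^ (b - 1) * (1 / (N + 1)) ≤ (H + 1 / (N + 1)) ^ b :=
        pow_add_mul_le_add_pow (by linarith) (by positivity) b
      have hb2 : 1 / (2 * N - 2) * ((b : ℝ) ^ 2 * C') ≤ C * (b * (1 / (N + 1))) := by
        have e1 : 1 / (2 * N - 2) ≤ 2 * (1 / (N + 1)) := by
          rw [mul_one_div, div_le_div_iff₀ hD (by linarith)]
          linarith
        calc 1 / (2 * N - 2) * ((b : ℝ) ^ 2 * C') ≤ 2 * (1 / (N + 1)) * ((b : ℝ) ^ 2 * C') := by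
              gcongr
          _ = (2 * b * C') * (b * (1 / (N + 1))) := by ring
          _ ≤ _ := by
              gcongr
              have : 0 ≤ M * n₀ ^ j + 2 ^ j * A := by positivity
              linarith
      have hjn : 0 ≤ (j : ℝ) / (N - 1) := div_nonneg (Nat.cast_nonneg _) (by linarith)
      have hQ : (1 + j / (N - 1)) * r ^ j ≤ (N / (((p : ℕ) : ℝ) + 1)) ^ j := by
        rw [← hrs, mul_pow, mul_comm]
        exact mul_le_mul_of_nonneg_left hj (pow_nonneg hr0 j)
      rw [mul_right_comm] at hHb
      refine h1.trans ((add_le_add (mul_le_mul_of_nonneg_left h2 (by linarith))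
        (mul_le_mul_of_nonneg_left h3 (by positivity))).trans ?_)
      exact growth_step_le hjn hC0 (pow_nonneg (by linarith) _) (pow_nonneg hr0 _)
        (by positivity) (pow_nonneg (by linarith) _) hb2 hHb hQ

end Moments

section Potential

/-- An upper bound for the degree of `p` and for `childDeg` at `p`. -/
def pot {n : ℕ} (G : SimpleGraph (Fin n)) (p : Fin n) : ℝ := deg G p + childDeg G p + 1

lemma pot_pos {n : ℕ} (G : SimpleGraph (Fin n)) (p : Fin n) : 0 < pot G p := by
  unfold pot; positivity

lemma pot_pow_le {n : ℕ} (G : SimpleGraph (Fin n)) (p : Fin n) (m : ℕ) :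
    pot G p ^ m ≤ 2 ^ m * (vertexMoment m 0 G p + vertexMoment 0 m G p) := by
  have h1 : (deg G p : ℝ) ^ m ≤ vertexMoment m 0 G p := by
    have : (deg G p) ^ m ≤ (deg G p).ascFactorial m := Nat.pow_succ_le_ascFactorial _ _
    simp only [vertexMoment, Nat.ascFactorial_zero, Nat.cast_one, mul_one]
    exact_mod_cast this
  have h2 : ((childDeg G p : ℝ) + 1) ^ m ≤ vertexMoment 0 m G p := by
    have : (childDeg G p + 1) ^ m ≤ (childDeg G p + 1).ascFactorial m :=
      Nat.pow_succ_le_ascFactorial _ _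
    simp only [vertexMoment, Nat.ascFactorial_zero, Nat.cast_one, one_mul]
    exact_mod_cast this
  have h3 := add_pow_le (a := (deg G p : ℝ)) (b := (childDeg G p : ℝ) + 1)
    (by positivity) (by positivity) m
  calc pot G p ^ m = ((deg G p : ℝ) + (childDeg G p + 1)) ^ m := by rw [pot, add_assoc]
    _ ≤ 2 ^ (m - 1) * ((deg G p : ℝ) ^ m + (childDeg G p + 1) ^ m) := h3
    _ ≤ 2 ^ m * (vertexMoment m 0 G p + vertexMoment 0 m G p) := by
        gcongr
        · norm_num
        · omega

lemma hsum_eq_sum_fin (n : ℕ) : hsum n = ∑ p : Fin n, 1 / (((p : ℕ) : ℝ) + 1) := by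
  rw [hsum, Finset.sum_range]

variable {n₀ : ℕ} {S : SimpleGraph (Fin n₀)}

lemma exists_expect_pot_pow_le (hS : S.IsTree) (hn₀ : 2 ≤ n₀) (j : ℕ) :
    ∃ C : ℝ, 0 ≤ C ∧ ∀ k, ∀ p : Fin (n₀ + k),
      expect S k (fun G => pot G p ^ (2 * j)) ≤
        C * hsum (n₀ + k) ^ (2 * j) * (((n₀ + k : ℕ) : ℝ) / ((p : ℕ) + 1)) ^ j := by
  obtain ⟨C₁, hC₁, h₁⟩ := exists_expect_vertexMoment_le hS hn₀ j 0 (Nat.zero_le _)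
  obtain ⟨C₂, hC₂, h₂⟩ := exists_expect_vertexMoment_le hS hn₀ j (2 * j) le_rfl
  refine ⟨2 ^ (2 * j) * (C₁ + C₂), by positivity, fun k p => ?_⟩
  have hN2 : (2 : ℝ) ≤ ((n₀ + k : ℕ) : ℝ) := by exact_mod_cast le_add_right hn₀
  have hH1 : 1 ≤ hsum (n₀ + k) ^ (2 * j) := one_le_pow₀ (one_le_hsum (by omega))
  have hr : ((((n₀ + k : ℕ) : ℝ) - 1) / ((p : ℕ) + 1)) ^ j ≤
      (((n₀ + k : ℕ) : ℝ) / ((p : ℕ) + 1)) ^ j := by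
    refine pow_le_pow_left₀ (div_nonneg (by linarith) (by positivity)) ?_ j
    gcongr
    linarith
  have hr0 : 0 ≤ (((n₀ + k : ℕ) : ℝ) / ((p : ℕ) + 1)) ^ j := by positivity
  have hq0 : 0 ≤ ((((n₀ + k : ℕ) : ℝ) - 1) / ((p : ℕ) + 1)) ^ j :=
    pow_nonneg (div_nonneg (by linarith) (by positivity)) j
  have h₁' := h₁ k p
  have h₂' := h₂ k p
  rw [Nat.sub_zero] at h₁'
  rw [Nat.sub_self] at h₂'
  set r := (((n₀ + k : ℕ) : ℝ) / ((p : ℕ) + 1)) ^ j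
  set H := hsum (n₀ + k) ^ (2 * j)
  have b₁ : expect S k (fun G => vertexMoment (2 * j) 0 G p) ≤ C₁ * H * r := by
    refine h₁'.trans ?_
    rw [pow_zero]
    gcongr
  have b₂ : expect S k (fun G => vertexMoment 0 (2 * j) G p) ≤ C₂ * H * r := by
    refine h₂'.trans ?_
    gcongr
  calc expect S k (fun G => pot G p ^ (2 * j))
      ≤ expect S k (fun G => 2 ^ (2 * j) *
          (vertexMoment (2 * j) 0 G p + vertexMoment 0 (2 * j) G p)) :=
        expect_mono hS hn₀ fun G _ => pot_pow_le G p _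
    _ = 2 ^ (2 * j) * (expect S k (fun G => vertexMoment (2 * j) 0 G p) +
          expect S k (fun G => vertexMoment 0 (2 * j) G p)) := by
        rw [expect_const_mul, expect_add]
    _ ≤ 2 ^ (2 * j) * (C₁ * H * r + C₂ * H * r) := by gcongr
    _ = _ := by ring

lemma exists_expect_sum_pot_pow_le (hS : S.IsTree) (hn₀ : 2 ≤ n₀) (j : ℕ) (hj : 1 ≤ j) :
    ∃ C : ℝ, 0 ≤ C ∧ ∀ k, expect S k (fun G => ∑ p, pot G p ^ (2 * j)) ≤
        C * hsum (n₀ + k) ^ (2 * j + 1) * ((n₀ + k : ℕ) : ℝ) ^ j := by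
  obtain ⟨C, hC, h⟩ := exists_expect_pot_pow_le hS hn₀ j
  refine ⟨C, hC, fun k => ?_⟩
  have hH1 : 1 ≤ hsum (n₀ + k) := one_le_hsum (by omega)
  rw [expect_sum]
  calc ∑ p, expect S k (fun G => pot G p ^ (2 * j))
      ≤ ∑ p : Fin (n₀ + k), C * hsum (n₀ + k) ^ (2 * j) * ((n₀ + k : ℕ) : ℝ) ^ j *
          (1 / (((p : ℕ) : ℝ) + 1)) := by
        refine Finset.sum_le_sum fun p _ => (h k p).trans ?_
        rw [div_eq_mul_one_div, mul_pow, ← mul_assoc]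
        have : (1 / (((p : ℕ) : ℝ) + 1)) ^ j ≤ 1 / (((p : ℕ) : ℝ) + 1) := by
          refine pow_le_of_le_one (by positivity) ?_ (by omega)
          rw [div_le_one (by positivity)]
          linarith [(Nat.cast_nonneg (p : ℕ) : (0 : ℝ) ≤ _)]
        gcongr
    _ = _ := by rw [← Finset.mul_sum, ← hsum_eq_sum_fin]; ring

lemma sum_sq_pow_four_le {n : ℕ} (x : Fin n → ℝ) :
    (∑ p, x p ^ 2) ^ 4 ≤ hsum n ^ 3 * ∑ p : Fin n, (((p : ℕ) : ℝ) + 1) ^ 3 * x p ^ 8 := by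
  have hH : 0 ≤ hsum n := Finset.sum_nonneg fun i _ => by positivity
  have h1 : (∑ p, x p ^ 2) ^ 2 ≤ hsum n * ∑ p : Fin n, (((p : ℕ) : ℝ) + 1) * x p ^ 4 := by
    rw [hsum_eq_sum_fin]
    refine Finset.sum_sq_le_sum_mul_sum_of_sq_le_mul _ (fun p _ => by positivity)
      (fun p _ => by positivity) fun p _ => le_of_eq ?_
    field_simp
  have h2 : (∑ p : Fin n, (((p : ℕ) : ℝ) + 1) * x p ^ 4) ^ 2 ≤
      hsum n * ∑ p : Fin n, (((p : ℕ) : ℝ) + 1) ^ 3 * x p ^ 8 := by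
    rw [hsum_eq_sum_fin]
    refine Finset.sum_sq_le_sum_mul_sum_of_sq_le_mul _ (fun p _ => by positivity)
      (fun p _ => by positivity) fun p _ => le_of_eq ?_
    field_simp
  calc (∑ p, x p ^ 2) ^ 4 = ((∑ p, x p ^ 2) ^ 2) ^ 2 := by ring
    _ ≤ (hsum n * ∑ p : Fin n, (((p : ℕ) : ℝ) + 1) * x p ^ 4) ^ 2 := by gcongr
    _ = hsum n ^ 2 * (∑ p : Fin n, (((p : ℕ) : ℝ) + 1) * x p ^ 4) ^ 2 := by ring
    _ ≤ hsum n ^ 2 * (hsum n * ∑ p : Fin n, (((p : ℕ) : ℝ) + 1) ^ 3 * x p ^ 8) := by gcongr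
    _ = _ := by ring

lemma exists_expect_sum_pot_sq_pow_le (hS : S.IsTree) (hn₀ : 2 ≤ n₀) :
    ∃ C : ℝ, 0 ≤ C ∧ ∀ k, expect S k (fun G => (∑ p, pot G p ^ 2) ^ 4) ≤
        C * hsum (n₀ + k) ^ 12 * ((n₀ + k : ℕ) : ℝ) ^ 4 := by
  obtain ⟨C, hC, h⟩ := exists_expect_pot_pow_le hS hn₀ 4
  refine ⟨C, hC, fun k => ?_⟩
  have hH1 : 1 ≤ hsum (n₀ + k) := one_le_hsum (by omega)
  calc expect S k (fun G => (∑ p, pot G p ^ 2) ^ 4)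
      ≤ expect S k (fun G => hsum (n₀ + k) ^ 3 *
          ∑ p : Fin (n₀ + k), (((p : ℕ) : ℝ) + 1) ^ 3 * pot G p ^ 8) :=
        expect_mono hS hn₀ fun G _ => sum_sq_pow_four_le _
    _ = hsum (n₀ + k) ^ 3 * ∑ p : Fin (n₀ + k), (((p : ℕ) : ℝ) + 1) ^ 3 *
          expect S k (fun G => pot G p ^ 8) := by
        rw [expect_const_mul, expect_sum]
        simp only [expect_const_mul]
    _ ≤ hsum (n₀ + k) ^ 3 * ∑ p : Fin (n₀ + k), (((p : ℕ) : ℝ) + 1) ^ 3 *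
          (C * hsum (n₀ + k) ^ 8 * (((n₀ + k : ℕ) : ℝ) / ((p : ℕ) + 1)) ^ 4) := by
        gcongr with p
        exact h k p
    _ = hsum (n₀ + k) ^ 3 * ∑ p : Fin (n₀ + k), (C * hsum (n₀ + k) ^ 8 *
          ((n₀ + k : ℕ) : ℝ) ^ 4) * (1 / (((p : ℕ) : ℝ) + 1)) := by
        congr 1
        refine Finset.sum_congr rfl fun p _ => ?_
        field_simp
    _ = _ := by rw [← Finset.mul_sum, ← hsum_eq_sum_fin]; ring

/-- The maximum of `pot` over all vertices. -/
def maxPot {n : ℕ} (G : SimpleGraph (Fin n)) : ℝ := ⨆ p, pot G p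

lemma pot_le_maxPot {n : ℕ} (G : SimpleGraph (Fin n)) (p : Fin n) : pot G p ≤ maxPot G :=
  le_ciSup (Set.finite_range _).bddAbove p

lemma maxPot_nonneg {n : ℕ} (G : SimpleGraph (Fin n)) : 0 ≤ maxPot G :=
  Real.iSup_nonneg fun p => (pot_pos G p).le

lemma maxPot_pow_le {n : ℕ} (hn : 0 < n) (G : SimpleGraph (Fin n)) (m : ℕ) :
    maxPot G ^ m ≤ ∑ p, pot G p ^ m := by
  have : Nonempty (Fin n) := ⟨⟨0, hn⟩⟩
  obtain ⟨p, hp⟩ := exists_eq_ciSup_of_finite (f := fun p => pot G p)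
  rw [maxPot, ← hp]
  exact Finset.single_le_sum (f := fun p => pot G p ^ m)
    (fun p _ => pow_nonneg (pot_pos G p).le m) (Finset.mem_univ p)

lemma exists_expect_maxPot_mul_le (hS : S.IsTree) (hn₀ : 2 ≤ n₀) (m : ℕ) :
    ∃ C : ℝ, 0 ≤ C ∧ ∀ k, expect S k (fun G => maxPot G ^ m * (∑ p, pot G p ^ 2) ^ 2) ^ 2 ≤
        C * hsum (n₀ + k) ^ (2 * m + 13) * ((n₀ + k : ℕ) : ℝ) ^ (m + 4) := by
  obtain ⟨C, hC, h⟩ : ∃ C : ℝ, 0 ≤ C ∧ ∀ k, expect S k (fun G => (maxPot G ^ m) ^ 2) ≤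
      C * hsum (n₀ + k) ^ (2 * m + 1) * ((n₀ + k : ℕ) : ℝ) ^ m := by
    rcases Nat.eq_zero_or_pos m with rfl | hm
    · refine ⟨1, zero_le_one, fun k => ?_⟩
      simp only [pow_zero, one_pow, mul_one, one_mul]
      rw [expect_const hS hn₀]
      exact one_le_pow₀ (one_le_hsum (by omega))
    · obtain ⟨C, hC, h⟩ := exists_expect_sum_pot_pow_le hS hn₀ m hm
      refine ⟨C, hC, fun k => le_trans (expect_mono hS hn₀ fun G _ => ?_) (h k)⟩
      rw [← pow_mul, mul_comm]
      exact maxPot_pow_le (by omega) G _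
  obtain ⟨C', hC', h'⟩ := exists_expect_sum_pot_sq_pow_le hS hn₀
  refine ⟨C * C', mul_nonneg hC hC', fun k => ?_⟩
  have hH1 : 1 ≤ hsum (n₀ + k) := one_le_hsum (by omega)
  have h1 := expect_mul_sq_le S hn₀ k (fun G => maxPot G ^ m) (fun G => (∑ p, pot G p ^ 2) ^ 2)
  refine h1.trans ?_
  have h2 : expect S k (fun G => ((∑ p, pot G p ^ 2) ^ 2) ^ 2) ≤
      C' * hsum (n₀ + k) ^ 12 * ((n₀ + k : ℕ) : ℝ) ^ 4 := by
    simp only [← pow_mul]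
    exact h' k
  calc _ ≤ (C * hsum (n₀ + k) ^ (2 * m + 1) * ((n₀ + k : ℕ) : ℝ) ^ m) *
        (C' * hsum (n₀ + k) ^ 12 * ((n₀ + k : ℕ) : ℝ) ^ 4) :=
        mul_le_mul (h k) h2 (expect_nonneg S hn₀ fun G => by positivity) (by positivity)
    _ = _ := by ring

end Potential

section HomCount

/-- The weighted number of homomorphisms from `G` to `T`, each vertex `x` of `T` carrying the
weight `d x`. -/
def homSum {V M : Type} [Fintype V] [Fintype M] (G : SimpleGraph V) (T : SimpleGraph M)
    (d : M → ℝ) (l : V → ℕ) : ℝ :=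
  ∑ φ : V → M, if ∀ a b, G.Adj a b → T.Adj (φ a) (φ b) then ∏ u, d (φ u) ^ l u else 0

variable {M : Type} [Fintype M] {T : SimpleGraph M} {d : M → ℝ} {X Y : ℝ}

/-- Removing a vertex `v` with a neighbour `u` from `G` splits a sum over homomorphisms. -/
lemma homSum_le_sum_remove {V : Type} [Fintype V] (G : SimpleGraph V) (hd : ∀ x, 0 ≤ d x)
    (l : V → ℕ) {u v : V} (huv : G.Adj u v) :
    homSum G T d l ≤ ∑ ψ : {w // w ≠ v} → M,
      if ∀ a b : {w // w ≠ v}, G.Adj a b → T.Adj (ψ a) (ψ b) then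
        (∏ w, d (ψ w) ^ l w) * ∑ x, if T.Adj (ψ ⟨u, huv.ne⟩) x then d x ^ l v else 0
      else 0 := by
  rw [homSum, ← (Equiv.funSplitAt v M).symm.sum_comp, Fintype.sum_prod_type_right]
  refine Finset.sum_le_sum fun ψ _ => ?_
  have hprod : ∀ x, ∏ w, d ((Equiv.funSplitAt v M).symm (x, ψ) w) ^ l w =
      (∏ w : {w // w ≠ v}, d (ψ w) ^ l w) * d x ^ l v := by
    intro x
    rw [Fintype.prod_eq_mul_prod_subtype_ne _ v, mul_comm]
    congr 1
    · refine Finset.prod_congr rfl fun w _ => ?_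
      simp [Equiv.funSplitAt, Equiv.piSplitAt, w.2]
    · simp [Equiv.funSplitAt, Equiv.piSplitAt]
  have hval : ∀ x (a : {w // w ≠ v}), (Equiv.funSplitAt v M).symm (x, ψ) a = ψ a := by
    intro x a
    simp [Equiv.funSplitAt, Equiv.piSplitAt, a.2]
  have hval' : ∀ x, (Equiv.funSplitAt v M).symm (x, ψ) v = x := by
    intro x
    simp [Equiv.funSplitAt, Equiv.piSplitAt]
  have hnn : 0 ≤ ∏ w : {w // w ≠ v}, d (ψ w) ^ l w :=
    Finset.prod_nonneg fun w _ => pow_nonneg (hd _) _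
  simp only [hprod]
  split_ifs with h
  · rw [Finset.mul_sum]
    refine Finset.sum_le_sum fun x _ => ?_
    split_ifs with h1 h2 h2
    · exact le_rfl
    · refine absurd ?_ h2
      have := h1 u v huv
      rwa [hval', hval x ⟨u, huv.ne⟩] at this
    · exact mul_nonneg hnn (pow_nonneg (hd _) _)
    · simp
  · refine le_of_eq (Finset.sum_eq_zero fun x _ => if_neg fun h1 => h fun a b hab => ?_)
    have := h1 a b hab
    rwa [hval, hval] at this

lemma sum_adj_pow_le (hd : ∀ x, 0 ≤ d x) (hX : ∀ x, d x ≤ X) {m : ℕ} (hm : 0 < m) (y : M) :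
    (∑ x, if T.Adj y x then d x ^ m else 0) ≤ X ^ (m - 1) * ∑ x, if T.Adj y x then d x else 0 := by
  rw [Finset.mul_sum]
  refine Finset.sum_le_sum fun x _ => ?_
  split_ifs
  · obtain ⟨m, rfl⟩ := Nat.exists_eq_succ_of_ne_zero hm.ne'
    rw [pow_succ, Nat.succ_sub_one]
    exact mul_le_mul_of_nonneg_right (pow_le_pow_left₀ (hd x) (hX x) _) (hd x)
  · simp

lemma homSum_le (hd : ∀ x, 0 ≤ d x) (hX0 : 0 ≤ X) (hX : ∀ x, d x ≤ X)
    (hN : ∀ x, (∑ y, if T.Adj x y then d y else 0) ≤ X) (hY : ∑ x, d x ^ 2 ≤ Y)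
    (hY' : ∑ x, d x * (∑ y, if T.Adj x y then d y else 0) ≤ Y)
    (N : ℕ) : ∀ {V : Type} [Fintype V] (G : SimpleGraph V), Fintype.card V = N → G.Connected →
      ∀ l : V → ℕ, (∀ u, 0 < l u) → 2 ≤ ∑ u, l u →
      homSum G T d l ≤ X ^ (∑ u, l u - 2) * Y := by
  induction N with
  | zero =>
    intro V _ G hc hG
    have := hG.nonempty
    exact absurd hc Fintype.card_ne_zero
  | succ N ih =>
    intro V _ G hc hG l hl hw
    rcases subsingleton_or_nontrivial V with hs | hnt
    · have : Unique V := (unique_iff_subsingleton_and_nonempty V).2 ⟨hs, hG.nonempty⟩ |>.some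
      rw [Fintype.sum_unique] at hw ⊢
      rw [homSum, ← (Equiv.funUnique V M).symm.sum_comp]
      refine le_trans ?_ (mul_le_mul_of_nonneg_left hY (pow_nonneg hX0 _))
      rw [Finset.mul_sum]
      refine Finset.sum_le_sum fun x _ => ?_
      have hx : d x ^ l default ≤ X ^ (l default - 2) * d x ^ 2 := by
        rw [← pow_sub_mul_pow (d x) hw]
        exact mul_le_mul_of_nonneg_right (pow_le_pow_left₀ (hd x) (hX x) _) (sq_nonneg _)
      split_ifs
      · rw [Fintype.prod_unique]
        exact hx
      · exact mul_nonneg (pow_nonneg hX0 _) (sq_nonneg _)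
    · obtain ⟨v, hv⟩ := hG.exists_connected_induce_compl_singleton_of_finite_nontrivial
      obtain ⟨u, hu⟩ := hG.preconnected.exists_adj_of_nontrivial v
      have huv := hu.symm
      let G' : SimpleGraph {w // w ≠ v} := G.comap Subtype.val
      have hG' : G'.Connected := hv
      have hw' : ∑ w, l w = l v + ∑ w : {w // w ≠ v}, l w :=
        Fintype.sum_eq_add_sum_subtype_ne l v
      have hcard : Fintype.card {w // w ≠ v} = N := by
        have := Fintype.card_subtype_compl (fun w => w = v)
        rw [Fintype.card_subtype_eq, hc] at this
        exact this
      have hprod : ∀ ψ : {w // w ≠ v} → M, 0 ≤ ∏ w, d (ψ w) ^ l w := fun ψ =>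
        Finset.prod_nonneg fun w _ => pow_nonneg (hd _) _
      have hs0 : ∀ y, 0 ≤ ∑ x, if T.Adj y x then d x else 0 := fun y =>
        Finset.sum_nonneg fun x _ => by split_ifs <;> simp [hd]
      refine (homSum_le_sum_remove G hd l huv).trans ?_
      by_cases h2 : 2 ≤ ∑ w : {w // w ≠ v}, l w
      · have hstep : ∀ y, (∑ x, if T.Adj y x then d x ^ l v else 0) ≤ X ^ l v := by
          intro y
          refine (sum_adj_pow_le hd hX (hl v) y).trans ?_
          rw [← pow_sub_one_mul (hl v).ne']
          exact mul_le_mul_of_nonneg_left (hN y) (pow_nonneg hX0 _)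
        have hi := ih G' hcard hG' (fun w => l w) (fun w => hl w) h2
        refine le_trans (b := homSum G' T d (fun w => l w) * X ^ l v) ?_ ?_
        · rw [homSum, Finset.sum_mul]
          suffices hterm : ∀ ψ : {w // w ≠ v} → M,
              (if ∀ a b : {w // w ≠ v}, G.Adj a b → T.Adj (ψ a) (ψ b) then
                (∏ w, d (ψ w) ^ l w) * ∑ x, if T.Adj (ψ ⟨u, huv.ne⟩) x then d x ^ l v else 0
                else 0) ≤
              (if ∀ a b, G'.Adj a b → T.Adj (ψ a) (ψ b) then ∏ w, d (ψ w) ^ l w else 0) *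
                X ^ l v by
            convert Finset.sum_le_sum fun ψ (_ : ψ ∈ Finset.univ) => hterm ψ
          intro ψ
          split_ifs with h3 h4 h4
          · exact mul_le_mul_of_nonneg_left (hstep _) (hprod ψ)
          · exact absurd h3 h4
          · exact absurd h4 h3
          · simp
        · rw [hw', show l v + ∑ w : {w // w ≠ v}, l w - 2
            = (∑ w : {w // w ≠ v}, l w - 2) + l v by omega, pow_add, mul_right_comm]
          exact mul_le_mul_of_nonneg_right hi (pow_nonneg hX0 _)
      · have h1 : ∑ w : {w // w ≠ v}, l w ≤ 1 := by omega
        have hle : ∀ w : {w // w ≠ v}, l w ≤ 1 := fun w =>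
          le_trans (Finset.single_le_sum (f := fun w : {w // w ≠ v} => l w)
            (fun _ _ => Nat.zero_le _) (Finset.mem_univ w)) h1
        have hc1 : Fintype.card {w // w ≠ v} ≤ 1 := by
          refine le_trans ?_ h1
          rw [Fintype.card_eq_sum_ones]
          exact Finset.sum_le_sum fun w _ => hl w
        have hsub : Subsingleton {w // w ≠ v} := Fintype.card_le_one_iff_subsingleton.1 hc1
        let iu : Unique {w // w ≠ v} := ⟨⟨⟨u, huv.ne⟩⟩, fun _ => Subsingleton.elim _ _⟩
        have hlu : l u = 1 := le_antisymm (hle ⟨u, huv.ne⟩) (hl u)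
        have hdef : ((default : {w // w ≠ v}) : V) = u := rfl
        have hsum : ∑ w : {w // w ≠ v}, l w = 1 := by
          rw [Fintype.sum_unique, hdef, hlu]
        rw [hw', hsum, show l v + 1 - 2 = l v - 1 by omega,
          ← (Equiv.funUnique {w // w ≠ v} M).symm.sum_comp]
        refine le_trans ?_ (mul_le_mul_of_nonneg_left hY' (pow_nonneg hX0 _))
        rw [Finset.mul_sum]
        refine Finset.sum_le_sum fun y _ => ?_
        have hy := mul_le_mul_of_nonneg_left (sum_adj_pow_le (T := T) hd hX (hl v) y) (hd y)
        split_ifs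
        · rw [Fintype.prod_unique, hdef, hlu, pow_one]
          refine hy.trans (le_of_eq ?_)
          ring
        · exact mul_nonneg (pow_nonneg hX0 _) (mul_nonneg (hd y) (hs0 y))

end HomCount

section UpperBound

variable {n₀ n : ℕ} {G : SimpleGraph (Fin n)}

lemma Dval_nonneg (τ : DecTree) (G : SimpleGraph (Fin n)) : 0 ≤ Dval τ G :=
  Finset.sum_nonneg fun φ _ => by
    split_ifs
    · exact Finset.prod_nonneg fun u _ => Nat.cast_nonneg _
    · exact le_rfl

lemma Dpair_nonneg (τ τ' : DecTree) (G : SimpleGraph (Fin n)) : 0 ≤ Dpair τ τ' G :=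
  Finset.sum_nonneg fun φ _ => Finset.sum_nonneg fun ψ _ => by
    split_ifs
    · exact mul_nonneg (Finset.prod_nonneg fun u _ => Nat.cast_nonneg _)
        (Finset.prod_nonneg fun u _ => Nat.cast_nonneg _)
    · exact le_rfl

lemma Dpair_le_mul (τ τ' : DecTree) (G : SimpleGraph (Fin n)) :
    Dpair τ τ' G ≤ Dval τ G * Dval τ' G := by
  rw [Dpair, Dval, Dval, Finset.sum_mul_sum]
  refine Finset.sum_le_sum fun φ _ => Finset.sum_le_sum fun ψ _ => ?_
  by_cases h : Function.Injective φ ∧ Function.Injective ψ ∧ (∀ a b, φ a ≠ ψ b) ∧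
      (∀ a b, τ.graph.Adj a b → G.Adj (φ a) (φ b)) ∧
      (∀ a b, τ'.graph.Adj a b → G.Adj (ψ a) (ψ b))
  · rw [if_pos h, if_pos ⟨h.1, h.2.2.2.1⟩, if_pos ⟨h.2.1, h.2.2.2.2⟩]
  · rw [if_neg h]
    refine mul_nonneg ?_ ?_ <;> split_ifs <;>
      first
        | exact Finset.prod_nonneg fun u _ => Nat.cast_nonneg _
        | exact le_rfl

lemma Dval_le_homSum (τ : DecTree) (G : SimpleGraph (Fin n)) :
    Dval τ G ≤ homSum τ.graph G (fun x => (deg G x : ℝ)) τ.label := by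
  have hterm : ∀ φ : Fin τ.n → Fin n,
      (if Function.Injective φ ∧ ∀ a b, τ.graph.Adj a b → G.Adj (φ a) (φ b) then
        ∏ u, ((deg G (φ u)).descFactorial (τ.label u) : ℝ) else 0) ≤
      if ∀ a b, τ.graph.Adj a b → G.Adj (φ a) (φ b) then
        ∏ u, (deg G (φ u) : ℝ) ^ τ.label u else 0 := by
    intro φ
    by_cases h : ∀ a b, τ.graph.Adj a b → G.Adj (φ a) (φ b)
    · rw [if_pos h]
      split_ifs
      · refine Finset.prod_le_prod (fun u _ => Nat.cast_nonneg _) fun u _ => ?_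
        exact_mod_cast Nat.descFactorial_le_pow _ _
      · exact Finset.prod_nonneg fun u _ => pow_nonneg (Nat.cast_nonneg _) _
    · rw [if_neg h, if_neg fun h' => h h'.2]
  have hsum := Finset.sum_le_sum fun φ (_ : φ ∈ Finset.univ) => hterm φ
  rw [Dval, homSum]
  convert hsum
  rfl

lemma deg_le_pot (G : SimpleGraph (Fin n)) (p : Fin n) : (deg G p : ℝ) ≤ pot G p := by
  rw [pot]
  have : (0 : ℝ) ≤ childDeg G p := Nat.cast_nonneg _
  linarith

lemma sum_neighbor_deg_le (h : Reachable n₀ G) (p : Fin n) :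
    (∑ c, if G.Adj p c then (deg G c : ℝ) else 0) ≤ (n₀ + 1) * maxPot G := by
  have h1 : (∑ c, if G.Adj p c then (deg G c : ℝ) else 0) ≤
      (childDeg G p : ℝ) + (oldDeg G p : ℝ) * maxPot G := by
    rw [childDeg, oldDeg]
    push_cast
    rw [Finset.sum_mul, ← Finset.sum_add_distrib]
    refine Finset.sum_le_sum fun c _ => ?_
    have hc := (deg_le_pot G c).trans (pot_le_maxPot G c)
    by_cases hadj : G.Adj p c
    · rcases lt_or_gt_of_ne hadj.ne with hlt | hlt
      · simp [hadj, hlt, hlt.not_gt]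
      · simpa [hadj, hlt, hlt.not_gt] using hc
    · simp [hadj]
  have h2 : (childDeg G p : ℝ) ≤ maxPot G := by
    refine le_trans ?_ (pot_le_maxPot G p)
    rw [pot]
    have : (0 : ℝ) ≤ deg G p := Nat.cast_nonneg _
    linarith
  have h3 : (oldDeg G p : ℝ) * maxPot G ≤ n₀ * maxPot G :=
    mul_le_mul_of_nonneg_right (by exact_mod_cast h.oldDeg_le p) (maxPot_nonneg G)
  linarith

lemma sum_deg_mul_neighbor_deg_le (G : SimpleGraph (Fin n)) :
    ∑ p, (deg G p : ℝ) * (∑ c, if G.Adj p c then (deg G c : ℝ) else 0) ≤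
      2 * ∑ p, pot G p ^ 2 := by
  have h1 : ∑ p, (deg G p : ℝ) * (∑ c, if G.Adj p c then (deg G c : ℝ) else 0) =
      2 * ∑ p, (deg G p : ℝ) * childDeg G p := by
    have h2 : ∑ p, (deg G p : ℝ) * childDeg G p =
        ∑ p, ∑ c, if G.Adj p c ∧ p < c then (deg G p : ℝ) * deg G c else 0 := by
      refine Finset.sum_congr rfl fun p _ => ?_
      rw [childDeg]
      push_cast
      rw [Finset.mul_sum]
      exact Finset.sum_congr rfl fun c _ => mul_ite_zero _ _ _
    have h3 : ∑ p, (deg G p : ℝ) * childDeg G p =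
        ∑ p, ∑ c, if G.Adj p c ∧ c < p then (deg G p : ℝ) * deg G c else 0 := by
      rw [h2, Finset.sum_comm]
      refine Finset.sum_congr rfl fun p _ => Finset.sum_congr rfl fun c _ => ?_
      rw [G.adj_comm, mul_comm]
    rw [two_mul]
    nth_rw 1 [h2]
    rw [h3, ← Finset.sum_add_distrib]
    refine Finset.sum_congr rfl fun p _ => ?_
    rw [Finset.mul_sum, ← Finset.sum_add_distrib]
    refine Finset.sum_congr rfl fun c _ => ?_
    by_cases hadj : G.Adj p c
    · rcases lt_or_gt_of_ne hadj.ne with hlt | hlt <;> simp [hadj, hlt, hlt.not_gt]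
    · simp [hadj]
  rw [h1]
  refine mul_le_mul_of_nonneg_left (Finset.sum_le_sum fun p _ => ?_) zero_le_two
  have hd : (0 : ℝ) ≤ deg G p := Nat.cast_nonneg _
  have hc : (0 : ℝ) ≤ childDeg G p := Nat.cast_nonneg _
  rw [pot]
  nlinarith [mul_nonneg hd hc]

lemma Dval_le (h : Reachable n₀ G) (τ : DecTree) (hw : 2 ≤ τ.weight) :
    Dval τ G ≤ ((n₀ + 1) * maxPot G) ^ (τ.weight - 2) * (2 * ∑ p, pot G p ^ 2) := by
  have hX := maxPot_nonneg G
  refine (Dval_le_homSum τ G).trans (homSum_le (fun x => Nat.cast_nonneg _) (by positivity)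
    (fun x => ?_) (sum_neighbor_deg_le h) ?_ (sum_deg_mul_neighbor_deg_le G) _ τ.graph rfl
    τ.isTree.connected τ.label τ.label_pos hw)
  · refine ((deg_le_pot G x).trans (pot_le_maxPot G x)).trans ?_
    have : (0 : ℝ) ≤ n₀ := Nat.cast_nonneg _
    nlinarith
  · rw [Finset.mul_sum]
    refine Finset.sum_le_sum fun p _ => ?_
    have hp := pow_le_pow_left₀ (Nat.cast_nonneg (α := ℝ) (deg G p)) (deg_le_pot G p) 2
    nlinarith [sq_nonneg (pot G p)]

end UpperBound

section LowerBound

lemma add_mul_descFactorial_le (d l : ℕ) :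
    (d + l) * d.descFactorial l ≤ d * (d + 1).descFactorial l := by
  rcases lt_or_ge d l with h | h
  · rw [Nat.descFactorial_eq_zero_iff_lt.2 h, mul_zero]
    exact Nat.zero_le _
  · obtain ⟨e, rfl⟩ := Nat.exists_eq_add_of_le h
    have h1 := Nat.succ_descFactorial (l + e) l
    rw [show l + e + 1 - l = e + 1 by omega] at h1
    refine le_of_mul_le_mul_left (a := e + 1) ?_ (Nat.succ_pos e)
    calc (e + 1) * ((l + e + l) * (l + e).descFactorial l)
        = ((e + 1) * (l + e + l)) * (l + e).descFactorial l := by ring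
      _ ≤ ((l + e) * (l + e + 1)) * (l + e).descFactorial l := by
          refine Nat.mul_le_mul_right _ ?_
          have : l ≤ l * l := Nat.le_mul_self l
          nlinarith
      _ = (l + e) * ((e + 1) * (l + e + 1).descFactorial l) := by rw [h1]; ring
      _ = _ := by ring

lemma add_sum_mul_prod_descFactorial_le {V : Type*} [Fintype V] {n : ℕ} (d : Fin n → ℕ)
    (l : V → ℕ) {ψ : V → Fin n} (hψ : Function.Injective ψ) (v : Fin n) :
    (d v + ∑ u, if ψ u = v then l u else 0) * ∏ u, (d (ψ u)).descFactorial (l u) ≤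
      d v * ∏ u, (d (ψ u) + if ψ u = v then 1 else 0).descFactorial (l u) := by
  by_cases h : ∃ u, ψ u = v
  · obtain ⟨u, rfl⟩ := h
    simp only [hψ.eq_iff, Finset.sum_ite_eq', Finset.mem_univ, if_true]
    rw [← Finset.mul_prod_erase _ _ (Finset.mem_univ u),
      ← Finset.mul_prod_erase _ (fun w => (d (ψ w) + if w = u then 1 else 0).descFactorial (l w))
        (Finset.mem_univ u), ← mul_assoc, ← mul_assoc, if_pos rfl]
    have he : ∏ w ∈ Finset.univ.erase u, (d (ψ w) + if w = u then 1 else 0).descFactorial (l w) =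
        ∏ w ∈ Finset.univ.erase u, (d (ψ w)).descFactorial (l w) :=
      Finset.prod_congr rfl fun w hw => by rw [if_neg (Finset.ne_of_mem_erase hw), add_zero]
    rw [he]
    exact Nat.mul_le_mul_right _ (add_mul_descFactorial_le _ _)
  · simp only [not_exists] at h
    simp [h]

lemma sum_comp_castSucc_le {V : Type*} [Fintype V] [DecidableEq V] {n : ℕ}
    {f : (V → Fin (n + 1)) → ℝ} (hf : ∀ φ, 0 ≤ f φ) :
    ∑ ψ : V → Fin n, f (fun u => (ψ u).castSucc) ≤ ∑ φ, f φ := by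
  let e : (V → Fin n) ↪ (V → Fin (n + 1)) :=
    ⟨fun ψ u => (ψ u).castSucc, fun ψ ψ' h =>
      funext fun u => Fin.castSucc_injective n (congrFun h u)⟩
  refine (Finset.sum_map Finset.univ e f).symm.trans_le ?_
  exact Finset.sum_le_sum_of_subset_of_nonneg (Finset.subset_univ _) fun φ _ _ => hf φ

lemma mul_Dval_le_sum {n₀ n : ℕ} {H : SimpleGraph (Fin n)} (hH : Reachable n₀ H) (τ : DecTree) :
    (2 * (n : ℝ) - 2 + τ.weight) * Dval τ H ≤ ∑ v, (deg H v : ℝ) * Dval τ (attach H v) := by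
  have hlow : ∀ v, (∑ ψ : Fin τ.n → Fin n,
      if Function.Injective ψ ∧ ∀ a b, τ.graph.Adj a b → H.Adj (ψ a) (ψ b) then
        ∏ u, ((deg H (ψ u) + if ψ u = v then 1 else 0).descFactorial (τ.label u) : ℝ)
      else 0) ≤ Dval τ (attach H v) := by
    intro v
    rw [Dval]
    refine le_trans (le_of_eq ?_) (sum_comp_castSucc_le fun φ => ?_)
    · refine Finset.sum_congr rfl fun ψ _ => ?_
      have hinj : (Function.Injective fun u => (ψ u).castSucc) ↔ Function.Injective ψ :=
        (Fin.castSucc_injective n).of_comp_iff ψ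
      simp only [hinj, attach_adj_castSucc, deg_attach_castSucc]
    · split_ifs
      · exact Finset.prod_nonneg fun u _ => Nat.cast_nonneg _
      · exact le_rfl
  refine le_trans ?_ (Finset.sum_le_sum fun v _ =>
    mul_le_mul_of_nonneg_left (hlow v) (Nat.cast_nonneg (deg H v)))
  simp only [Finset.mul_sum, Dval]
  rw [Finset.sum_comm]
  refine Finset.sum_le_sum fun ψ _ => ?_
  by_cases h : Function.Injective ψ ∧ ∀ a b, τ.graph.Adj a b → H.Adj (ψ a) (ψ b)
  · simp only [if_pos h]
    have hs : (2 * (n : ℝ) - 2 + τ.weight) =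
        ∑ v, ((deg H v + ∑ u, if ψ u = v then τ.label u else 0 : ℕ) : ℝ) := by
      push_cast
      rw [Finset.sum_add_distrib, hH.sum_deg, Finset.sum_comm, DecTree.weight]
      simp
    rw [hs, Finset.sum_mul]
    refine Finset.sum_le_sum fun v _ => ?_
    exact_mod_cast add_sum_mul_prod_descFactorial_le (deg H) τ.label h.1 v
  · simp only [if_neg h, mul_zero, Finset.sum_const_zero, le_refl]

variable {n₀ : ℕ} {S : SimpleGraph (Fin n₀)}

lemma expect_Dval_succ_ge (hS : S.IsTree) (hn₀ : 2 ≤ n₀) (τ : DecTree) (k : ℕ) :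
    (1 + τ.weight / (2 * (n₀ + k : ℕ) - 2)) * expect S k (Dval τ) ≤
      expect S (k + 1) (Dval τ) := by
  have h : (2 : ℝ) ≤ ((n₀ + k : ℕ) : ℝ) := by exact_mod_cast le_add_right hn₀
  have hpos : (0 : ℝ) < 2 * (n₀ + k : ℕ) - 2 := by linarith
  refine le_trans ?_ (expect_succ S k (Dval τ)).ge
  rw [← expect_const_mul]
  refine expect_mono hS hn₀ fun H hH => ?_
  rw [le_div_iff₀ hpos]
  refine le_trans (le_of_eq ?_) (mul_Dval_le_sum hH τ)
  rw [mul_right_comm, add_mul, one_mul, div_mul_cancel₀ _ hpos.ne']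

lemma exists_law_pos_hom (hS : S.IsTree) (hn₀ : 2 ≤ n₀) (N : ℕ) :
    ∀ {V : Type} [Fintype V] (G : SimpleGraph V), Fintype.card V = N → G.IsTree →
      ∃ (k : ℕ) (H : SimpleGraph (Fin (n₀ + k))) (φ : V → Fin (n₀ + k)), 0 < law S k H ∧
        Function.Injective φ ∧ ∀ a b, G.Adj a b → H.Adj (φ a) (φ b) := by
  induction N with
  | zero =>
    intro V _ G hc hG
    have := hG.connected.nonempty
    exact absurd hc Fintype.card_ne_zero
  | succ N ih =>
    intro V _ G hc hG
    rcases subsingleton_or_nontrivial V with hs | hnt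
    · refine ⟨0, S, fun _ => ⟨0, by omega⟩, ?_, Function.injective_of_subsingleton _, ?_⟩
      · simp [law]
      · intro a b hab
        exact absurd (Subsingleton.elim a b) hab.ne
    · obtain ⟨v, hv⟩ := hG.exists_vert_degree_one_of_nontrivial
      obtain ⟨u, huv, hu⟩ := SimpleGraph.degree_eq_one_iff_existsUnique_adj.1 hv
      have hcard : Fintype.card {w // w ≠ v} = N := by
        have := Fintype.card_subtype_compl (fun w => w = v)
        rw [Fintype.card_subtype_eq, hc] at this
        exact this
      have hG' : (G.comap (Subtype.val : {w // w ≠ v} → V)).IsTree :=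
        ⟨hG.connected.induce_compl_singleton_of_degree_eq_one hv,
          hG.isAcyclic.of_comap (Function.Embedding.subtype _)⟩
      obtain ⟨k, H, φ, hH, hφ, hadj⟩ := ih _ hcard hG'
      refine ⟨k + 1, attach H (φ ⟨u, huv.ne'⟩),
        fun w => if h : w = v then Fin.last _ else (φ ⟨w, h⟩).castSucc,
        law_attach_pos hS hn₀ hH _, ?_, ?_⟩
      · intro a b hab
        by_cases ha : a = v <;> by_cases hb : b = v
        · rw [ha, hb]
        · simp only [dif_pos ha, dif_neg hb] at hab
          exact absurd hab (Fin.castSucc_lt_last _).ne'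
        · simp only [dif_neg ha, dif_pos hb] at hab
          exact absurd hab (Fin.castSucc_lt_last _).ne
        · simp only [dif_neg ha, dif_neg hb] at hab
          exact congrArg Subtype.val (hφ (Fin.castSucc_injective _ hab))
      · intro a b hab
        by_cases ha : a = v <;> by_cases hb : b = v
        · exact absurd (ha.trans hb.symm) hab.ne
        · subst ha
          obtain rfl := hu b hab
          simp only [dif_pos, dif_neg hb]
          exact (attach_adj_last_castSucc _ _ _).2 rfl
        · subst hb
          obtain rfl := hu a hab.symm
          simp only [dif_pos, dif_neg ha]
          exact (attach_adj_castSucc_last _ _ _).2 rfl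
        · simp only [dif_neg ha, dif_neg hb]
          exact (attach_adj_castSucc _ _ _ _).2 (hadj ⟨a, ha⟩ ⟨b, hb⟩ hab)

lemma exists_law_pos_hom_le_deg (hS : S.IsTree) (hn₀ : 2 ≤ n₀) {V : Type} [Fintype V]
    (G : SimpleGraph V) (l : V → ℕ) (N : ℕ) :
    ∀ (k : ℕ) (H : SimpleGraph (Fin (n₀ + k))) (φ : V → Fin (n₀ + k)), 0 < law S k H →
      Function.Injective φ → (∀ a b, G.Adj a b → H.Adj (φ a) (φ b)) →
      ∑ u, (l u - deg H (φ u)) ≤ N →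
      ∃ (k : ℕ) (H : SimpleGraph (Fin (n₀ + k))) (φ : V → Fin (n₀ + k)), 0 < law S k H ∧
        Function.Injective φ ∧ (∀ a b, G.Adj a b → H.Adj (φ a) (φ b)) ∧
        ∀ u, l u ≤ deg H (φ u) := by
  induction N with
  | zero =>
    intro k H φ hH hφ hadj hN
    refine ⟨k, H, φ, hH, hφ, hadj, fun u => ?_⟩
    have := (Finset.sum_eq_zero_iff.1 (Nat.le_zero.1 hN)) u (Finset.mem_univ u)
    omega
  | succ N ih =>
    intro k H φ hH hφ hadj hN
    by_cases h : ∀ u, l u ≤ deg H (φ u)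
    · exact ⟨k, H, φ, hH, hφ, hadj, h⟩
    · push Not at h
      obtain ⟨u, hu⟩ := h
      refine ih (k + 1) (attach H (φ u)) (fun w => (φ w).castSucc) (law_attach_pos hS hn₀ hH _)
        ((Fin.castSucc_injective _).comp hφ)
        (fun a b hab => (attach_adj_castSucc _ _ _ _).2 (hadj a b hab)) ?_
      refine Nat.le_of_lt_succ (lt_of_lt_of_le ?_ hN)
      refine Finset.sum_lt_sum (fun w _ => ?_) ⟨u, Finset.mem_univ u, ?_⟩
      · rw [deg_attach_castSucc]
        omega
      · rw [deg_attach_castSucc, if_pos rfl]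
        omega

lemma exists_expect_Dval_pos (hS : S.IsTree) (hn₀ : 2 ≤ n₀) (τ : DecTree) :
    ∃ k, 0 < expect S k (Dval τ) := by
  obtain ⟨k, H, φ, hH, hφ, hadj⟩ := exists_law_pos_hom hS hn₀ _ τ.graph rfl τ.isTree
  obtain ⟨k, H, φ, hH, hφ, hadj, hdeg⟩ :=
    exists_law_pos_hom_le_deg hS hn₀ τ.graph τ.label _ k H φ hH hφ hadj le_rfl
  refine ⟨k, Finset.sum_pos' (fun G _ => mul_nonneg (law_nonneg S hn₀ k G) (Dval_nonneg τ G))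
    ⟨H, Finset.mem_univ _, mul_pos hH ?_⟩⟩
  refine Finset.sum_pos' (fun ψ _ => ?_) ⟨φ, Finset.mem_univ _, ?_⟩
  · split_ifs
    · exact Finset.prod_nonneg fun u _ => Nat.cast_nonneg _
    · exact le_rfl
  · rw [if_pos ⟨hφ, hadj⟩]
    refine Finset.prod_pos fun u _ => Nat.cast_pos.2 (Nat.pos_of_ne_zero fun h0 => ?_)
    exact absurd (Nat.descFactorial_eq_zero_iff_lt.1 h0) (hdeg u).not_gt

/-- The mean of `D_τ` grows at least like `n ^ (w(τ) / 2)`. -/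
lemma exists_pow_weight_le_expect_Dval_sq (hS : S.IsTree) (hn₀ : 2 ≤ n₀) (τ : DecTree) :
    ∃ (c : ℝ) (K : ℕ), 0 < c ∧ ∀ k, K ≤ k →
      ((n₀ + k : ℕ) : ℝ) ^ τ.weight ≤ c * expect S k (Dval τ) ^ 2 := by
  obtain ⟨K, hK⟩ := exists_expect_Dval_pos hS hn₀ τ
  set w := τ.weight with hw
  set A := expect S K (Dval τ) with hA
  set B : ℝ := ((n₀ + K - 1).ascFactorial w : ℝ) with hB
  have hBpos : 0 < B := by
    have h : 0 < (n₀ + K - 1) ^ w := pow_pos (by omega) _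
    exact Nat.cast_pos.2 (h.trans_le (Nat.pow_succ_le_ascFactorial _ _))
  have key : ∀ k, K ≤ k →
      A ^ 2 * ((n₀ + k - 1).ascFactorial w : ℝ) ≤ expect S k (Dval τ) ^ 2 * B := by
    intro k hk
    induction k, hk using Nat.le_induction with
    | base => exact le_rfl
    | succ k hk ih =>
      obtain ⟨m, hm⟩ : ∃ m, n₀ + k = m + 1 + 1 := ⟨n₀ + k - 2, by omega⟩
      have hstep := expect_Dval_succ_ge hS hn₀ τ k
      have h0 : 0 ≤ expect S k (Dval τ) := expect_nonneg S hn₀ fun G => Dval_nonneg τ G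
      have h1 : n₀ + k - 1 = m + 1 := by omega
      have h2 : n₀ + (k + 1) - 1 = m + 1 + 1 := by omega
      rw [h1] at ih
      rw [h2]
      have hasc : ((m + 1 : ℕ) : ℝ) * ((m + 1 + 1).ascFactorial w : ℝ) =
          (((m + 1 : ℕ) : ℝ) + w) * ((m + 1).ascFactorial w : ℝ) := by
        exact_mod_cast Nat.succ_ascFactorial (m + 1) w
      set M : ℝ := ((m + 1 : ℕ) : ℝ) with hM
      have hMpos : 0 < M := by rw [hM]; exact_mod_cast Nat.succ_pos m
      have hden : (2 * ((n₀ + k : ℕ) : ℝ) - 2) = 2 * M := by rw [hm, hM]; push_cast; ring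
      rw [hden] at hstep
      set a := expect S k (Dval τ) with ha
      have hw0 : (0 : ℝ) ≤ w := Nat.cast_nonneg _
      have hsq : ((1 + w / (2 * M)) * a) ^ 2 ≤ expect S (k + 1) (Dval τ) ^ 2 :=
        pow_le_pow_left₀ (by positivity) hstep 2
      have hsq' : (M + w) * a ^ 2 ≤ M * expect S (k + 1) (Dval τ) ^ 2 := by
        refine le_trans ?_ (mul_le_mul_of_nonneg_left hsq hMpos.le)
        have : M * ((1 + w / (2 * M)) * a) ^ 2 = (M + w) * a ^ 2 + w ^ 2 / (4 * M) * a ^ 2 := by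
          field_simp
          ring
        rw [this]
        have : 0 ≤ (w : ℝ) ^ 2 / (4 * M) * a ^ 2 := by positivity
        linarith
      refine le_of_mul_le_mul_left ?_ hMpos
      calc M * (A ^ 2 * ((m + 1 + 1).ascFactorial w : ℝ))
          = (M + w) * (A ^ 2 * ((m + 1).ascFactorial w : ℝ)) := by
            rw [mul_left_comm, hasc]; ring
        _ ≤ (M + w) * (a ^ 2 * B) := mul_le_mul_of_nonneg_left ih (by positivity)
        _ = (M + w) * a ^ 2 * B := by ring
        _ ≤ M * expect S (k + 1) (Dval τ) ^ 2 * B := mul_le_mul_of_nonneg_right hsq' hBpos.le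
        _ = _ := by ring
  refine ⟨2 ^ w * B / A ^ 2, K, by positivity, fun k hk => ?_⟩
  have h1 : ((n₀ + k : ℕ) : ℝ) ^ w ≤ 2 ^ w * ((n₀ + k - 1).ascFactorial w : ℝ) := by
    have h2 : (n₀ + k) ^ w ≤ 2 ^ w * (n₀ + k - 1).ascFactorial w :=
      calc (n₀ + k) ^ w ≤ (2 * (n₀ + k - 1)) ^ w := Nat.pow_le_pow_left (by omega) _
        _ = 2 ^ w * (n₀ + k - 1) ^ w := mul_pow _ _ _
        _ ≤ _ := Nat.mul_le_mul_left _ (Nat.pow_succ_le_ascFactorial _ _)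
    exact_mod_cast h2
  refine h1.trans ?_
  rw [div_mul_eq_mul_div, le_div_iff₀ (by positivity)]
  have h3 := mul_le_mul_of_nonneg_left (key k hk) (show (0 : ℝ) ≤ 2 ^ w by positivity)
  linarith

end LowerBound

section Assembly

variable {n₀ : ℕ} {S : SimpleGraph (Fin n₀)}

lemma DecTree.weight_pos (τ : DecTree) : 0 < τ.weight := by
  obtain ⟨u⟩ := τ.isTree.connected.nonempty
  exact Finset.sum_pos (fun u _ => τ.label_pos u) ⟨u, Finset.mem_univ u⟩

lemma Dval_eq_of_weight_eq_one {n : ℕ} {G : SimpleGraph (Fin n)} (h : Reachable n₀ G)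
    {τ : DecTree} (hw : τ.weight = 1) : Dval τ G = 2 * n - 2 := by
  obtain ⟨u⟩ := τ.isTree.connected.nonempty
  have hcard : Fintype.card (Fin τ.n) ≤ 1 := by
    rw [← hw, DecTree.weight, Fintype.card_eq_sum_ones]
    exact Finset.sum_le_sum fun u _ => τ.label_pos u
  have hsub := Fintype.card_le_one_iff_subsingleton.1 hcard
  let iu : Unique (Fin τ.n) := ⟨⟨u⟩, fun _ => Subsingleton.elim _ _⟩
  have hl : τ.label default = 1 := by rwa [DecTree.weight, Fintype.sum_unique] at hw
  rw [Dval, ← h.sum_deg, ← (Equiv.funUnique (Fin τ.n) (Fin n)).symm.sum_comp]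
  refine Finset.sum_congr rfl fun x _ => ?_
  rw [if_pos ⟨Function.injective_of_subsingleton _,
    fun a b hab => absurd (Subsingleton.elim a b) hab.ne⟩, Fintype.prod_unique, hl,
    Nat.descFactorial_one]
  rfl

lemma expect_Dpair_le_of_weight_eq_one (hS : S.IsTree) (hn₀ : 2 ≤ n₀) {τ τ' : DecTree}
    (hw : τ.weight = 1 ∨ τ'.weight = 1) (k : ℕ) :
    expect S k (Dpair τ τ') ≤ expect S k (Dval τ) * expect S k (Dval τ') := by
  refine (expect_mono hS hn₀ fun G _ => Dpair_le_mul τ τ' G).trans (le_of_eq ?_)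
  rcases hw with hw | hw
  · rw [expect_congr hS hn₀ (F := Dval τ) fun G hG => Dval_eq_of_weight_eq_one hG hw,
      expect_const hS hn₀, ← expect_const_mul]
    exact expect_congr hS hn₀ fun G hG => by rw [Dval_eq_of_weight_eq_one hG hw]
  · rw [expect_congr hS hn₀ (F := Dval τ') fun G hG => Dval_eq_of_weight_eq_one hG hw,
      expect_const hS hn₀, mul_comm (expect S k (Dval τ)), ← expect_const_mul]
    exact expect_congr hS hn₀ fun G hG => by rw [Dval_eq_of_weight_eq_one hG hw, mul_comm]

lemma exists_expect_Dpair_sq_le (hS : S.IsTree) (hn₀ : 2 ≤ n₀) {τ τ' : DecTree}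
    (hw : 2 ≤ τ.weight) (hw' : 2 ≤ τ'.weight) :
    ∃ (C : ℝ) (a : ℕ), 0 ≤ C ∧ ∀ k, expect S k (Dpair τ τ') ^ 2 ≤
      C * hsum (n₀ + k) ^ a * ((n₀ + k : ℕ) : ℝ) ^ (τ.weight + τ'.weight) := by
  obtain ⟨r, hr⟩ := Nat.exists_eq_add_of_le hw
  obtain ⟨r', hr'⟩ := Nat.exists_eq_add_of_le hw'
  obtain ⟨C, hC, h⟩ := exists_expect_maxPot_mul_le hS hn₀ (r + r')
  set D : ℝ := 4 * ((n₀ : ℝ) + 1) ^ (r + r') with hD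
  refine ⟨D ^ 2 * C, 2 * (r + r') + 13, by positivity, fun k => ?_⟩
  have hle : expect S k (Dpair τ τ') ≤
      D * expect S k (fun G => maxPot G ^ (r + r') * (∑ p, pot G p ^ 2) ^ 2) := by
    rw [← expect_const_mul]
    refine expect_mono hS hn₀ fun G hG => (Dpair_le_mul τ τ' G).trans ?_
    have hX := maxPot_nonneg G
    have h1 := Dval_le hG τ hw
    have h2 := Dval_le hG τ' hw'
    rw [show τ.weight - 2 = r by omega] at h1
    rw [show τ'.weight - 2 = r' by omega] at h2
    refine (mul_le_mul h1 h2 (Dval_nonneg τ' G) (by positivity)).trans (le_of_eq ?_)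
    rw [hD, mul_pow, mul_pow]
    ring
  have h0 : 0 ≤ expect S k (Dpair τ τ') := expect_nonneg S hn₀ fun G => Dpair_nonneg τ τ' G
  calc _ ≤ (D * expect S k (fun G => maxPot G ^ (r + r') * (∑ p, pot G p ^ 2) ^ 2)) ^ 2 :=
        pow_le_pow_left₀ h0 hle 2
    _ ≤ D ^ 2 * (C * hsum (n₀ + k) ^ (2 * (r + r') + 13) *
          ((n₀ + k : ℕ) : ℝ) ^ (r + r' + 4)) := by
        rw [mul_pow]
        exact mul_le_mul_of_nonneg_left (h k) (sq_nonneg D)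
    _ = _ := by rw [hr, hr', show 2 + r + (2 + r') = r + r' + 4 by omega]; ring

lemma exists_expect_Dpair_le (hS : S.IsTree) (hn₀ : 2 ≤ n₀) (τ τ' : DecTree) :
    ∃ (C : ℝ) (a K : ℕ), 0 < C ∧ ∀ k, K ≤ k → expect S k (Dpair τ τ') ≤
      C * hsum (n₀ + k) ^ a * (expect S k (Dval τ) * expect S k (Dval τ')) := by
  by_cases hone : τ.weight = 1 ∨ τ'.weight = 1
  · refine ⟨1, 0, 0, one_pos, fun k _ => ?_⟩
    rw [pow_zero, one_mul, one_mul]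
    exact expect_Dpair_le_of_weight_eq_one hS hn₀ hone k
  have hw := τ.weight_pos
  have hw' := τ'.weight_pos
  obtain ⟨C, a, hC, h⟩ := exists_expect_Dpair_sq_le hS hn₀ (τ := τ) (τ' := τ')
    (by omega) (by omega)
  obtain ⟨c, K, hc, hK⟩ := exists_pow_weight_le_expect_Dval_sq hS hn₀ τ
  obtain ⟨c', K', hc', hK'⟩ := exists_pow_weight_le_expect_Dval_sq hS hn₀ τ'
  refine ⟨C * c * c' + 1, a, max K K', by positivity, fun k hk => ?_⟩
  have hH1 : 1 ≤ hsum (n₀ + k) := one_le_hsum (by omega)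
  have hE : 0 ≤ expect S k (Dval τ) := expect_nonneg S hn₀ fun G => Dval_nonneg τ G
  have hE' : 0 ≤ expect S k (Dval τ') := expect_nonneg S hn₀ fun G => Dval_nonneg τ' G
  refine (sq_le_sq₀ (expect_nonneg S hn₀ fun G => Dpair_nonneg τ τ' G) (by positivity)).1 ?_
  have hCc : C * c * c' ≤ (C * c * c' + 1) ^ 2 := by
    have : 0 ≤ C * c * c' := by positivity
    nlinarith
  have hHa : hsum (n₀ + k) ^ a ≤ (hsum (n₀ + k) ^ a) ^ 2 :=
    le_self_pow₀ (one_le_pow₀ hH1) two_ne_zero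
  calc _ ≤ C * hsum (n₀ + k) ^ a * ((n₀ + k : ℕ) : ℝ) ^ (τ.weight + τ'.weight) := h k
    _ ≤ C * hsum (n₀ + k) ^ a *
          ((c * expect S k (Dval τ) ^ 2) * (c' * expect S k (Dval τ') ^ 2)) := by
        rw [pow_add]
        refine mul_le_mul_of_nonneg_left ?_ (by positivity)
        exact mul_le_mul (hK k (le_of_max_le_left hk)) (hK' k (le_of_max_le_right hk))
          (by positivity) (by positivity)
    _ = C * c * c' * hsum (n₀ + k) ^ a * (expect S k (Dval τ) * expect S k (Dval τ')) ^ 2 := by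
        ring
    _ ≤ (C * c * c' + 1) ^ 2 * (hsum (n₀ + k) ^ a) ^ 2 *
          (expect S k (Dval τ) * expect S k (Dval τ')) ^ 2 := by gcongr
    _ = _ := by ring

end Assembly

/-- For all decorated trees `τ, τ'` and every seed tree `S`,
`E[D_{τ,τ'}(T_n^{(S)})] ≪ E[D_τ(T_n^{(S)})] · E[D_{τ'}(T_n^{(S)})]`. -/
theorem pair_moment_bound (τ τ' : DecTree)
    {n₀ : ℕ} (S : SimpleGraph (Fin n₀)) (hS : S.IsTree) (hn₀ : 2 ≤ n₀) :
    Lsim (fun n => ∑ G : SimpleGraph (Fin n), lawAt S n G * Dpair τ τ' G)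
      (fun n => expD S τ n * expD S τ' n) := by
  obtain ⟨C, a, K, hC, h⟩ := exists_expect_Dpair_le hS hn₀ τ τ'
  refine ⟨C * 2 ^ a, a, by positivity, ?_⟩
  filter_upwards [Filter.eventually_ge_atTop (n₀ + K), Filter.eventually_ge_atTop 3] with n hn hn3
  obtain ⟨k, rfl⟩ := Nat.exists_eq_add_of_le (show n₀ ≤ n by omega)
  have hlog : 1 ≤ Real.log ((n₀ + k : ℕ) : ℝ) := by
    rw [Real.le_log_iff_exp_le (by exact_mod_cast by omega)]
    have : (3 : ℝ) ≤ ((n₀ + k : ℕ) : ℝ) := by exact_mod_cast hn3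
    linarith [Real.exp_one_lt_three]
  have hH : hsum (n₀ + k) ≤ 2 * Real.log ((n₀ + k : ℕ) : ℝ) := by
    linarith [hsum_le (n₀ + k)]
  have hH1 : 1 ≤ hsum (n₀ + k) := one_le_hsum (by omega)
  have hE : 0 ≤ expect S k (Dval τ) * expect S k (Dval τ') :=
    mul_nonneg (expect_nonneg S hn₀ fun G => Dval_nonneg τ G)
      (expect_nonneg S hn₀ fun G => Dval_nonneg τ' G)
  have hP : 0 ≤ expect S k (Dpair τ τ') := expect_nonneg S hn₀ fun G => Dpair_nonneg τ τ' G
  simp only [expD, sum_lawAt]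
  rw [abs_of_nonneg hP, abs_of_nonneg hE, Real.rpow_natCast]
  refine (h k (by omega)).trans (mul_le_mul_of_nonneg_right ?_ hE)
  calc C * hsum (n₀ + k) ^ a ≤ C * (2 * Real.log ((n₀ + k : ℕ) : ℝ)) ^ a := by gcongr
    _ = _ := by rw [mul_pow]; ring

end LPAM
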